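/- arXiv:1109.0524 — 4 statements merged into one kernel-verified Lean document; each statement's English description precedes it below -/
import Mathlib

section
/- Let X_{n,i} = Σ_{t∈ℤ} f_{n,i,t} ε_{i−t} where the ε_i are i.i.d. with mean zero, variance one and finite fourth moment, and Σ_{t∈ℤ} f_{n,i,t}² = 1. Define h_n(k) = sup_{1≤i≤m} (Σ_{|t|≥⌊k/2⌋} f_{n,i,t}²)^{1/2}. Then for all 1 ≤ i, j ≤ m, |σ_{n,i,j}| ≤ 2 h_n(0) h_n(|i−j|) = 2 h_n(|i−j|), where σ_{n,i,j} = Σ_{t∈ℤ} f_{n,i,i−t} f_{n,j,j−t}. -/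
open Filter MeasureTheory Real

/-- `σ_{n,i,j} = ∑_{t ∈ ℤ} f_{n,i,i-t} f_{n,j,j-t}`. -/
noncomputable def sigmaF (f : ℕ → ℕ → ℤ → ℝ) (n i j : ℕ) : ℝ :=
  ∑' t : ℤ, f n i ((i : ℤ) - t) * f n j ((j : ℤ) - t)

/-- `h_n(k) = sup_{1 ≤ i ≤ m} (∑_{|t| ≥ ⌊k/2⌋} f_{n,i,t}²)^{1/2}`. -/
noncomputable def hFun (f : ℕ → ℕ → ℤ → ℝ) (m : ℕ → ℕ) (n k : ℕ) : ℝ :=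
  sSup {x : ℝ | ∃ i : ℕ, i < m n ∧
    x = Real.sqrt (∑' t : ℤ, if ((k / 2 : ℕ) : ℤ) ≤ |t| then (f n i t) ^ 2 else 0)}

theorem summable_abs_mul_of_summable_sq {ι : Type*} {a b : ι → ℝ}
    (ha : Summable fun t => a t ^ 2) (hb : Summable fun t => b t ^ 2) :
    Summable fun t => |a t * b t| := by
  refine Summable.of_nonneg_of_le (fun _ => abs_nonneg _) (fun t => ?_) (ha.add hb)
  rw [abs_mul, ← sq_abs (a t), ← sq_abs (b t)]
  nlinarith [sq_nonneg (|a t| - |b t|), sq_nonneg (|a t|), sq_nonneg (|b t|)]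

/-- The Cauchy-Schwarz inequality for square-summable real families. -/
theorem tsum_abs_mul_le_sqrt_mul_sqrt {ι : Type*} {a b : ι → ℝ}
    (ha : Summable fun t => a t ^ 2) (hb : Summable fun t => b t ^ 2) :
    ∑' t, |a t * b t| ≤ √(∑' t, a t ^ 2) * √(∑' t, b t ^ 2) := by
  refine (summable_abs_mul_of_summable_sq ha hb).tsum_le_of_sum_le fun s => ?_
  have h := Real.sum_mul_le_sqrt_mul_sqrt s (fun t => |a t|) (fun t => |b t|)
  simp only [sq_abs, ← abs_mul] at h
  refine h.trans (mul_le_mul ?_ ?_ (Real.sqrt_nonneg _) (Real.sqrt_nonneg _))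
  · exact Real.sqrt_le_sqrt (ha.sum_le_tsum s fun _ _ => sq_nonneg _)
  · exact Real.sqrt_le_sqrt (hb.sum_le_tsum s fun _ _ => sq_nonneg _)

theorem summable_ite_sq {ι : Type*} {c : ι → ℝ} (R : ι → Prop) [DecidablePred R]
    (hc : Summable fun t => c t ^ 2) : Summable fun t => (if R t then c t else 0) ^ 2 := by
  refine Summable.of_nonneg_of_le (fun _ => sq_nonneg _) (fun t => ?_) hc
  split_ifs
  · exact le_rfl
  · simpa using sq_nonneg (c t)

/-- If at every index one of two conditions `P`, `Q` holds, the inner product of `a` and `b` is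
controlled by the restrictions of `a` to `P` and of `b` to `Q`. -/
theorem abs_tsum_mul_le_of_or {ι : Type*} {a b : ι → ℝ} (P Q : ι → Prop)
    [DecidablePred P] [DecidablePred Q]
    (ha : Summable fun t => a t ^ 2) (hb : Summable fun t => b t ^ 2) (hPQ : ∀ t, P t ∨ Q t) :
    |∑' t, a t * b t| ≤ √(∑' t, if P t then a t ^ 2 else 0) * √(∑' t, b t ^ 2)
      + √(∑' t, a t ^ 2) * √(∑' t, if Q t then b t ^ 2 else 0) := by
  have hA := summable_ite_sq P ha
  have hB := summable_ite_sq Q hb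
  have hsA := summable_abs_mul_of_summable_sq hA hb
  have hsB := summable_abs_mul_of_summable_sq ha hB
  have hab := summable_abs_mul_of_summable_sq ha hb
  have hA' := tsum_abs_mul_le_sqrt_mul_sqrt hA hb
  have hB' := tsum_abs_mul_le_sqrt_mul_sqrt ha hB
  have h₁ : |∑' t, a t * b t| ≤ ∑' t, |a t * b t| := by
    have h := norm_tsum_le_tsum_norm (f := fun t => a t * b t) hab
    simpa only [Real.norm_eq_abs] using h
  have h₂ := hab.tsum_le_tsum (fun t => show |a t * b t| ≤
      |(if P t then a t else 0) * b t| + |a t * (if Q t then b t else 0)| by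
    rcases hPQ t with h | h
    · rw [if_pos h]
      exact le_add_of_nonneg_right (abs_nonneg _)
    · rw [if_pos h]
      exact le_add_of_nonneg_left (abs_nonneg _)) (hsA.add hsB)
  rw [hsA.tsum_add hsB] at h₂
  simp only [ite_pow, zero_pow two_ne_zero] at hA' hB'
  linarith

theorem sqrt_tsum_tail_le_hFun (f : ℕ → ℕ → ℤ → ℝ) (m : ℕ → ℕ) {n i : ℕ} (k : ℕ)
    (hi : i < m n) :
    √(∑' t : ℤ, if ((k / 2 : ℕ) : ℤ) ≤ |t| then (f n i t) ^ 2 else 0) ≤ hFun f m n k := by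
  refine le_csSup (Set.Finite.bddAbove ?_) ⟨i, hi, rfl⟩
  refine ((Set.finite_Iio (m n)).image fun i =>
    √(∑' t : ℤ, if ((k / 2 : ℕ) : ℤ) ≤ |t| then (f n i t) ^ 2 else 0)).subset ?_
  rintro x ⟨i, hi, rfl⟩
  exact ⟨i, hi, rfl⟩

theorem hFun_zero (f : ℕ → ℕ → ℤ → ℝ) (m : ℕ → ℕ) {n : ℕ} (hm : 0 < m n)
    (hnorm : ∀ i, ∑' t : ℤ, (f n i t) ^ 2 = 1) : hFun f m n 0 = 1 := by
  have h : {x : ℝ | ∃ i : ℕ, i < m n ∧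
      x = √(∑' t : ℤ, if ((0 / 2 : ℕ) : ℤ) ≤ |t| then (f n i t) ^ 2 else 0)} = {1} := by
    ext x
    simp only [Nat.zero_div, Nat.cast_zero, abs_nonneg, if_true, hnorm, Real.sqrt_one,
      Set.mem_ofPred_eq, Set.mem_singleton_iff]
    exact ⟨fun ⟨_, _, hx⟩ => hx, fun hx => ⟨0, hm, hx⟩⟩
  rw [hFun, h, csSup_singleton]

/-- **Covariance decay of a linear process.**
Let `X_{n,i} = ∑_{t ∈ ℤ} f_{n,i,t} ε_{i-t}` with `∑_t f_{n,i,t}² = 1` (so `h_n(0) = 1`).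
Then for all `1 ≤ i, j ≤ m`, `|σ_{n,i,j}| ≤ 2 h_n(0) h_n(|i-j|) = 2 h_n(|i-j|)`. -/
theorem linear_process_sigma_bound
    (f : ℕ → ℕ → ℤ → ℝ) (m : ℕ → ℕ) (hmpos : ∀ n, 0 < m n)
    (hsq : ∀ n i, Summable fun t : ℤ => (f n i t) ^ 2)
    (hnorm : ∀ n i, ∑' t : ℤ, (f n i t) ^ 2 = 1) :
    ∀ n, ∀ i j : ℕ, i < m n → j < m n →
      |sigmaF f n i j| ≤ 2 * hFun f m n 0 * hFun f m n ((i : ℤ) - (j : ℤ)).natAbs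
        ∧ 2 * hFun f m n 0 * hFun f m n ((i : ℤ) - (j : ℤ)).natAbs
          = 2 * hFun f m n ((i : ℤ) - (j : ℤ)).natAbs := by
  intro n i j hi hj
  rw [hFun_zero f m (hmpos n) (hnorm n), mul_one]
  refine ⟨?_, rfl⟩
  set k := ((i : ℤ) - (j : ℤ)).natAbs with hk
  have hsummable (l : ℕ) : Summable fun t : ℤ => f n l ((l : ℤ) - t) ^ 2 :=
    (hsq n l).comp_injective (Equiv.subLeft (l : ℤ)).injective
  have hreflect (l : ℕ) (g : ℤ → ℝ) : ∑' t : ℤ, g ((l : ℤ) - t) = ∑' t, g t :=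
    (Equiv.subLeft (l : ℤ)).tsum_eq g
  have h := abs_tsum_mul_le_of_or (fun t : ℤ => ((k / 2 : ℕ) : ℤ) ≤ |(i : ℤ) - t|)
    (fun t : ℤ => ((k / 2 : ℕ) : ℤ) ≤ |(j : ℤ) - t|) (hsummable i) (hsummable j)
    (fun t => by
      by_contra! hlt
      simp only [abs_lt] at hlt
      omega)
  rw [hreflect i fun t => f n i t ^ 2, hreflect j fun t => f n j t ^ 2,
    hreflect i fun t => if ((k / 2 : ℕ) : ℤ) ≤ |t| then f n i t ^ 2 else 0,
    hreflect j fun t => if ((k / 2 : ℕ) : ℤ) ≤ |t| then f n j t ^ 2 else 0,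
    hnorm, hnorm, Real.sqrt_one, mul_one, one_mul] at h
  have h₁ := sqrt_tsum_tail_le_hFun f m k hi
  have h₂ := sqrt_tsum_tail_le_hFun f m k hj
  unfold sigmaF
  linarith
end

section
/- For each n ≥ 1 let (X_{n,i})_{i∈𝓘_n} be a Gaussian random vector whose entries have mean zero and variance one, with covariance matrix Σ_n = (r_{n,i,j}), |𝓘_n| = s_n → ∞, and assume Σ_n satisfies either condition (B1) or condition (B2). Let z ∈ ℝ and let (z_n) be positive reals with z_n² = 2 log s_n − log log s_n − log π + 2z + o(1). For d ≥ 1 define Q'_{n,d} = Σ_{𝓐⊂𝓘_n, |𝓐|=d} P( ⋂_{i∈𝓐} {|X_{n,i}| > z_n} ). Then lim_{n→∞} Q'_{n,d} = e^{−dz}/d! for every d ≥ 1. -/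
open Filter Asymptotics MeasureTheory ProbabilityTheory Real

/-- Covariance of two real random variables. -/
noncomputable def covRV {Ω : Type*} [MeasurableSpace Ω] (P : Measure Ω) (X Y : Ω → ℝ) : ℝ :=
  ∫ ω, (X ω - ∫ x, X x ∂P) * (Y ω - ∫ x, Y x ∂P) ∂P

/-- `γ(n,b) = sup_{i ∈ 𝓘ₙ} sup_{𝓐 ⊆ 𝓘ₙ, |𝓐| = b} inf_{j ∈ 𝓐} |r_{n,i,j}|`. -/
noncomputable def gammafun (s : ℕ → ℕ) (r : ∀ n, Fin (s n) → Fin (s n) → ℝ)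
    (n : ℕ) (b : ℕ) : ℝ :=
  sSup {x : ℝ | ∃ i : Fin (s n), ∃ 𝓐 : Finset (Fin (s n)), 𝓐.card = b ∧
    x = sInf ((fun j => |r n i j|) '' (𝓐 : Set (Fin (s n))))}

/-- `γ_n = sup_{i ≠ j ∈ 𝓘ₙ} |r_{n,i,j}|`. -/
noncomputable def gammamax (s : ℕ → ℕ) (r : ∀ n, Fin (s n) → Fin (s n) → ℝ) (n : ℕ) : ℝ :=
  sSup {x : ℝ | ∃ i j : Fin (s n), i ≠ j ∧ x = |r n i j|}

/-- Condition (B1): `γ(n, b_n) = o(1 / log b_n)` for any sequence `b_n → ∞`, and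
`limsup_n γ_n < 1`. -/
def CondB1 (s : ℕ → ℕ) (r : ∀ n, Fin (s n) → Fin (s n) → ℝ) : Prop :=
  (∀ b : ℕ → ℕ, Tendsto b atTop atTop →
      (fun n => gammafun s r n (b n)) =o[atTop] (fun n => 1 / Real.log (b n)))
    ∧ Filter.limsup (fun n => gammamax s r n) atTop < 1

/-- Condition (B2): `γ(n, b_n) = o(1)` for any sequence `b_n → ∞`,
`∑_{i ≠ j} r_{n,i,j}² = O(s_n^{2-δ})` for some `δ > 0`, and `limsup_n γ_n < 1`. -/
def CondB2 (s : ℕ → ℕ) (r : ∀ n, Fin (s n) → Fin (s n) → ℝ) : Prop :=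
  (∀ b : ℕ → ℕ, Tendsto b atTop atTop →
      Tendsto (fun n => gammafun s r n (b n)) atTop (nhds 0))
    ∧ (∃ δ : ℝ, 0 < δ ∧
        (fun n => ∑ i : Fin (s n), ∑ j : Fin (s n),
            if i ≠ j then (r n i j) ^ 2 else 0)
          =O[atTop] (fun n => ((s n : ℝ)) ^ ((2 : ℝ) - δ)))
    ∧ Filter.limsup (fun n => gammamax s r n) atTop < 1

section GaussianFamily

variable {Ω ι : Type*} [MeasurableSpace Ω] {P : Measure Ω} [Fintype ι]

/-- A finite family of centred, unit-variance random variables all of whose linear combinations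
are Gaussian. -/
structure IsStdGaussianFamily (X : ι → Ω → ℝ) (P : Measure Ω) : Prop where
  meas : ∀ i, Measurable (X i)
  gauss : ∀ c : ι → ℝ, ∃ (μ : ℝ) (v : NNReal),
    Measure.map (fun ω => ∑ i, c i * X i ω) P = gaussianReal μ v
  mean : ∀ i, ∫ ω, X i ω ∂P = 0
  var : ∀ i, variance (X i) P = 1

namespace IsStdGaussianFamily

variable {X : ι → Ω → ℝ}

/-- Restriction of a standardized Gaussian family to a subset of the indices. -/
lemma subfamily [DecidableEq ι] (h : IsStdGaussianFamily X P) (A : Finset ι) :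
    IsStdGaussianFamily (fun i : A => X i) P where
  meas i := h.meas i
  gauss c := by
    obtain ⟨μ, v, hv⟩ := h.gauss (fun i => if hi : i ∈ A then c ⟨i, hi⟩ else 0)
    refine ⟨μ, v, hv ▸ congrArg (fun f => Measure.map f P) ?_⟩
    funext ω
    simp only [dite_mul, zero_mul]
    rw [Finset.sum_dite]
    simp only [Finset.sum_const_zero, add_zero]
    exact Finset.sum_bij' (fun i _ => ⟨i, by simp⟩) (fun i _ => ⟨i, by simpa using i.2⟩)
      (by simp) (by simp) (by simp) (by simp) (by simp)
  mean i := h.mean i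
  var i := h.var i

variable [IsProbabilityMeasure P]

lemma memLp (h : IsStdGaussianFamily X P) (i : ι) : MemLp (X i) 2 P := by
  refine memLp_two_of_variance_ne_zero (h.meas i).aestronglyMeasurable ?_
  rw [h.var i]; exact one_ne_zero

lemma map_sum (h : IsStdGaussianFamily X P) (c : ι → ℝ) :
    Measure.map (fun ω => ∑ i, c i * X i ω) P =
      gaussianReal 0 (∑ i, ∑ j, c i * c j * cov[X i, X j; P]).toNNReal := by
  obtain ⟨μ, v, hv⟩ := h.gauss c
  have hm : AEMeasurable (fun ω => ∑ i, c i * X i ω) P :=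
    (Finset.measurable_fun_sum _ fun i _ => (h.meas i).const_mul _).aemeasurable
  have hL : ∀ i, MemLp (fun ω => c i * X i ω) 2 P := fun i => (h.memLp i).const_mul _
  have h1 : μ = 0 := by
    have := integral_id_gaussianReal (μ := μ) (v := v)
    rw [← hv, integral_map hm (by fun_prop), integral_finsetSum] at this
    · simpa [integral_const_mul, h.mean] using this.symm
    · exact fun i _ => (hL i).integrable one_le_two
  have h2 : (v : ℝ) = ∑ i, ∑ j, c i * c j * cov[X i, X j; P] := by
    have := variance_id_gaussianReal (μ := μ) (v := v)
    rw [← hv, variance_map (by fun_prop) hm] at this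
    rw [← this, ← covariance_self (by simpa using hm)]
    change cov[fun ω => ∑ i, c i * X i ω, fun ω => ∑ i, c i * X i ω; P] = _
    rw [covariance_fun_sum_fun_sum hL hL]
    simp_rw [covariance_const_mul_left, covariance_const_mul_right, mul_assoc]
  rw [hv, h1, ← h2, Real.toNNReal_coe]

lemma sum_cov_nonneg (h : IsStdGaussianFamily X P) (c : ι → ℝ) :
    0 ≤ ∑ i, ∑ j, c i * c j * cov[X i, X j; P] := by
  have hL : ∀ i, MemLp (fun ω => c i * X i ω) 2 P := fun i => (h.memLp i).const_mul _
  have := variance_nonneg (fun ω => ∑ i, c i * X i ω) P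
  rw [← covariance_self (Finset.measurable_fun_sum _ fun i _ =>
    (h.meas i).const_mul _).aemeasurable, covariance_fun_sum_fun_sum hL hL] at this
  simpa only [covariance_const_mul_left, covariance_const_mul_right, mul_assoc,
    mul_left_comm] using this

lemma abs_cov_le_one (h : IsStdGaussianFamily X P) (i j : ι) : |cov[X i, X j; P]| ≤ 1 := by
  have h1 := variance_nonneg (X i + X j) P
  have h2 := variance_nonneg (X i - X j) P
  rw [variance_add (h.memLp i) (h.memLp j), h.var, h.var] at h1
  rw [variance_sub (h.memLp i) (h.memLp j), h.var, h.var] at h2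
  exact abs_le.2 ⟨by linarith, by linarith⟩

/-- Chernoff bound for the event that all coordinates are large in absolute value. -/
lemma measure_forall_abs_gt_le (h : IsStdGaussianFamily X P) (z : ℝ) {u : ι → ℝ}
    (hu : ∀ i, 0 ≤ u i) :
    P.real (⋂ i, {ω | z < |X i ω|}) ≤ 2 ^ Fintype.card ι *
      exp (-(z * ∑ i, u i) + (∑ i, ∑ j, u i * u j * |cov[X i, X j; P]|) / 2) := by
  classical
  let sg : Bool → ℝ := fun b => if b then 1 else -1
  have hsg : ∀ b, |sg b| = 1 := by intro b; cases b <;> simp [sg]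
  have hsub : (⋂ i, {ω | z < |X i ω|}) ⊆
      ⋃ σ : ι → Bool, {ω | z * ∑ i, u i ≤ ∑ i, (sg (σ i) * u i) * X i ω} := by
    intro ω hω
    simp only [Set.mem_iInter, Set.mem_ofPred_eq] at hω
    refine Set.mem_iUnion.2 ⟨fun i => decide (0 ≤ X i ω), ?_⟩
    simp only [Set.mem_ofPred_eq, Finset.mul_sum]
    refine Finset.sum_le_sum fun i _ => ?_
    have : sg (decide (0 ≤ X i ω)) * X i ω = |X i ω| := by
      by_cases hx : 0 ≤ X i ω
      · simp [sg, hx, abs_of_nonneg]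
      · simp [sg, hx, abs_of_neg (not_le.1 hx)]
    calc z * u i ≤ |X i ω| * u i := mul_le_mul_of_nonneg_right (hω i).le (hu i)
      _ = _ := by rw [← this]; ring
  have hone : ∀ σ : ι → Bool,
      P.real {ω | z * ∑ i, u i ≤ ∑ i, (sg (σ i) * u i) * X i ω} ≤
      exp (-(z * ∑ i, u i) + (∑ i, ∑ j, u i * u j * |cov[X i, X j; P]|) / 2) := by
    intro σ
    have hl := h.map_sum (fun i => sg (σ i) * u i)
    have hm : AEMeasurable (fun ω => ∑ i, (sg (σ i) * u i) * X i ω) P :=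
      (Finset.measurable_fun_sum _ fun i _ => (h.meas i).const_mul _).aemeasurable
    have hint : Integrable (fun ω => exp (1 * ∑ i, (sg (σ i) * u i) * X i ω)) P := by
      have := integrable_exp_mul_gaussianReal (μ := 0) (v := (∑ i, ∑ j, (sg (σ i) * u i) *
        (sg (σ j) * u j) * cov[X i, X j; P]).toNNReal) 1
      rw [← hl] at this
      exact this.comp_aemeasurable hm
    refine (measure_ge_le_exp_mul_mgf (t := 1) _ zero_le_one hint).trans ?_
    rw [mgf_gaussianReal hl, ← exp_add, Real.coe_toNNReal _ (h.sum_cov_nonneg _)]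
    refine exp_le_exp.2 ?_
    have : ∑ i, ∑ j, (sg (σ i) * u i) * (sg (σ j) * u j) * cov[X i, X j; P] ≤
        ∑ i, ∑ j, u i * u j * |cov[X i, X j; P]| := by
      refine Finset.sum_le_sum fun i _ => Finset.sum_le_sum fun j _ => (le_abs_self _).trans ?_
      rw [abs_mul, abs_mul, abs_mul, abs_mul, hsg, hsg, abs_of_nonneg (hu i),
        abs_of_nonneg (hu j), one_mul, one_mul]
    linarith
  calc P.real (⋂ i, {ω | z < |X i ω|})
      ≤ P.real (⋃ σ : ι → Bool, {ω | z * ∑ i, u i ≤ ∑ i, (sg (σ i) * u i) * X i ω}) :=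
        measureReal_mono hsub
    _ ≤ ∑ σ : ι → Bool, P.real {ω | z * ∑ i, u i ≤ ∑ i, (sg (σ i) * u i) * X i ω} :=
        measureReal_iUnion_fintype_le _
    _ ≤ ∑ _σ : ι → Bool,
        exp (-(z * ∑ i, u i) + (∑ i, ∑ j, u i * u j * |cov[X i, X j; P]|) / 2) :=
        Finset.sum_le_sum fun σ _ => hone σ
    _ = _ := by simp

end IsStdGaussianFamily
end GaussianFamily

section PiGaussian

variable {ι : Type*} [Fintype ι]

/-- Density of the product of `|ι|` centred Gaussians of variance `v`. -/
lemma pi_gaussianReal_eq_withDensity {v : NNReal} (hv : v ≠ 0) :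
    Measure.pi (fun _ : ι => gaussianReal 0 v) =
      (volume : Measure (ι → ℝ)).withDensity
        (fun x => ENNReal.ofReal ((√(2 * π * v))⁻¹ ^ Fintype.card ι *
          exp (-(∑ i, x i ^ 2) / (2 * v)))) := by
  symm
  have hdens : ∀ x : ι → ℝ, (√(2 * π * v))⁻¹ ^ Fintype.card ι *
      exp (-(∑ i, x i ^ 2) / (2 * v)) = ∏ i, gaussianPDFReal 0 v (x i) := by
    intro x
    simp only [gaussianPDFReal, sub_zero, Finset.prod_mul_distrib, Finset.prod_const,
      Finset.card_univ, ← exp_sum, ← Finset.sum_div, Finset.sum_neg_distrib]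
  simp_rw [hdens]
  refine Eq.symm (Measure.pi_eq fun t ht => ?_)
  have hset : MeasurableSet (Set.univ.pi t) := MeasurableSet.univ_pi ht
  have hind : ∀ x : ι → ℝ, (Set.univ.pi t).indicator
      (fun x => ∏ i, gaussianPDFReal 0 v (x i)) x =
      ∏ i, (t i).indicator (gaussianPDFReal 0 v) (x i) := by
    intro x
    classical
    by_cases hx : x ∈ Set.univ.pi t
    · rw [Set.indicator_of_mem hx]
      exact Finset.prod_congr rfl fun i _ => (Set.indicator_of_mem (hx i trivial) _).symm
    · rw [Set.indicator_of_notMem hx]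
      simp only [Set.mem_univ_pi, not_forall] at hx
      obtain ⟨i, hi⟩ := hx
      exact (Finset.prod_eq_zero (Finset.mem_univ i) (Set.indicator_of_notMem hi _)).symm
  have hnn : ∀ i x, 0 ≤ (t i).indicator (gaussianPDFReal 0 v) x := fun i x =>
    Set.indicator_nonneg (fun x _ => gaussianPDFReal_nonneg 0 v x) x
  have hint : ∀ i, Integrable ((t i).indicator (gaussianPDFReal 0 v)) volume := fun i =>
    (integrable_gaussianPDFReal 0 v).indicator (ht i)
  rw [withDensity_apply _ hset, ← lintegral_indicator hset]
  have : ∀ x : ι → ℝ, (Set.univ.pi t).indicator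
      (fun x => ENNReal.ofReal (∏ i, gaussianPDFReal 0 v (x i))) x =
      ENNReal.ofReal (∏ i, (t i).indicator (gaussianPDFReal 0 v) (x i)) := by
    intro x
    rw [← hind]
    by_cases hx : x ∈ Set.univ.pi t <;> simp [hx]
  simp_rw [this]
  rw [← ofReal_integral_eq_lintegral_ofReal, integral_fintype_prod_volume_eq_prod,
    ENNReal.ofReal_prod_of_nonneg fun i _ => integral_nonneg (hnn i)]
  · refine Finset.prod_congr rfl fun i _ => ?_
    rw [gaussianReal_apply_eq_integral 0 hv, integral_indicator (ht i)]
  · exact Integrable.fintype_prod hint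
  · exact ae_of_all _ fun x => Finset.prod_nonneg fun i _ => hnn i _

/-- A function of the linear image of a vector, integrated against a scaled density. -/
lemma setLIntegral_comp_linearMap {T : (ι → ℝ) →ₗ[ℝ] (ι → ℝ)} (hT : LinearMap.det T ≠ 0)
    {g : (ι → ℝ) → ENNReal} (hg : Measurable g) {E : Set (ι → ℝ)} (hE : MeasurableSet E) :
    ∫⁻ x in T ⁻¹' E, g (T x) = ENNReal.ofReal |(LinearMap.det T)⁻¹| * ∫⁻ x in E, g x := by
  have hm : Measurable T := T.continuous_of_finiteDimensional.measurable
  rw [← setLIntegral_map hE hg hm, Measure.map_linearMap_addHaar_eq_smul_addHaar _ hT,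
    Measure.restrict_smul, lintegral_smul_measure, smul_eq_mul]

lemma gaussian_density_le {b q s : ℝ} (hb : 0 < b) (h : q ≤ b * s) (d : ℕ) :
    (√(2 * π))⁻¹ ^ d * exp (-s / 2) ≤
      √b ^ d * ((√(2 * π * b))⁻¹ ^ d * exp (-q / (2 * b))) := by
  rw [Real.sqrt_mul (show 0 ≤ 2 * π by positivity) b, mul_inv, mul_pow, ← mul_assoc,
    show √b ^ d * ((√(2 * π))⁻¹ ^ d * (√b)⁻¹ ^ d) = (√(2 * π))⁻¹ ^ d by
      rw [mul_left_comm, ← mul_pow, mul_inv_cancel₀ (by positivity), one_pow, mul_one]]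
  refine mul_le_mul_of_nonneg_left (exp_le_exp.2 ?_) (by positivity)
  rw [div_le_div_iff₀ (by positivity) (by positivity)]
  nlinarith

lemma le_gaussian_density {a q s : ℝ} (ha : 0 < a) (h : a * s ≤ q) (d : ℕ) :
    √a ^ d * ((√(2 * π * a))⁻¹ ^ d * exp (-q / (2 * a))) ≤
      (√(2 * π))⁻¹ ^ d * exp (-s / 2) := by
  rw [Real.sqrt_mul (show 0 ≤ 2 * π by positivity) a, mul_inv, mul_pow, ← mul_assoc,
    show √a ^ d * ((√(2 * π))⁻¹ ^ d * (√a)⁻¹ ^ d) = (√(2 * π))⁻¹ ^ d by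
      rw [mul_left_comm, ← mul_pow, mul_inv_cancel₀ (by positivity), one_pow, mul_one]]
  refine mul_le_mul_of_nonneg_left (exp_le_exp.2 ?_) (by positivity)
  rw [div_le_div_iff₀ (by positivity) (by positivity)]
  nlinarith

variable {T : (ι → ℝ) →ₗ[ℝ] (ι → ℝ)}

lemma pi_gaussianReal_preimage_le_aux {b : NNReal} (hb : b ≠ 0) (hT : LinearMap.det T ≠ 0)
    (h : ∀ w, ∑ i, T w i ^ 2 ≤ b * ∑ i, w i ^ 2) {E : Set (ι → ℝ)} (hE : MeasurableSet E) :
    (Measure.pi (fun _ : ι => gaussianReal 0 1)).real (T ⁻¹' E) ≤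
      √b ^ Fintype.card ι * |(LinearMap.det T)⁻¹| *
        (Measure.pi (fun _ : ι => gaussianReal 0 b)).real E := by
  have hm : Measurable T := T.continuous_of_finiteDimensional.measurable
  have key : Measure.pi (fun _ : ι => gaussianReal 0 1) (T ⁻¹' E) ≤
      ENNReal.ofReal (√b ^ Fintype.card ι) * (ENNReal.ofReal |(LinearMap.det T)⁻¹| *
        Measure.pi (fun _ : ι => gaussianReal 0 b) E) := by
    rw [pi_gaussianReal_eq_withDensity one_ne_zero, pi_gaussianReal_eq_withDensity hb,
      withDensity_apply _ (hm hE), withDensity_apply _ hE,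
      ← setLIntegral_comp_linearMap hT (by fun_prop) hE, ← lintegral_const_mul _ (by fun_prop)]
    refine lintegral_mono fun x => ?_
    rw [← ENNReal.ofReal_mul (by positivity)]
    refine ENNReal.ofReal_le_ofReal ?_
    simpa using gaussian_density_le (NNReal.coe_pos.2 (pos_iff_ne_zero.2 hb)) (h x)
      (Fintype.card ι)
  have := ENNReal.toReal_mono (by finiteness) key
  simpa [measureReal_def, mul_assoc, abs_inv] using this

lemma le_pi_gaussianReal_preimage_aux {a : NNReal} (ha : a ≠ 0) (hT : LinearMap.det T ≠ 0)
    (h : ∀ w, a * ∑ i, w i ^ 2 ≤ ∑ i, T w i ^ 2) {E : Set (ι → ℝ)} (hE : MeasurableSet E) :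
    √a ^ Fintype.card ι * |(LinearMap.det T)⁻¹| *
        (Measure.pi (fun _ : ι => gaussianReal 0 a)).real E ≤
      (Measure.pi (fun _ : ι => gaussianReal 0 1)).real (T ⁻¹' E) := by
  have hm : Measurable T := T.continuous_of_finiteDimensional.measurable
  have key : ENNReal.ofReal (√a ^ Fintype.card ι) * (ENNReal.ofReal |(LinearMap.det T)⁻¹| *
        Measure.pi (fun _ : ι => gaussianReal 0 a) E) ≤
      Measure.pi (fun _ : ι => gaussianReal 0 1) (T ⁻¹' E) := by
    rw [pi_gaussianReal_eq_withDensity one_ne_zero, pi_gaussianReal_eq_withDensity ha,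
      withDensity_apply _ (hm hE), withDensity_apply _ hE,
      ← setLIntegral_comp_linearMap hT (by fun_prop) hE, ← lintegral_const_mul _ (by fun_prop)]
    refine lintegral_mono fun x => ?_
    rw [← ENNReal.ofReal_mul (by positivity)]
    refine ENNReal.ofReal_le_ofReal ?_
    simpa using le_gaussian_density (NNReal.coe_pos.2 (pos_iff_ne_zero.2 ha)) (h x)
      (Fintype.card ι)
  have := ENNReal.toReal_mono (by finiteness) key
  simpa [measureReal_def, mul_assoc, abs_inv] using this

lemma det_ne_zero_of_le_sum_sq {a : ℝ} (ha : 0 < a)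
    (h : ∀ w, a * ∑ i, w i ^ 2 ≤ ∑ i, T w i ^ 2) : LinearMap.det T ≠ 0 := by
  intro h0
  obtain ⟨w, hw, hw0⟩ := (Submodule.ne_bot_iff _).1 (LinearMap.bot_lt_ker_of_det_eq_zero h0).ne'
  have h1 := h w
  rw [LinearMap.mem_ker.1 hw] at h1
  have h2 : ∑ i, w i ^ 2 ≤ 0 := by
    have : a * ∑ i, w i ^ 2 ≤ 0 := by simpa using h1
    exact nonpos_of_mul_nonpos_right this ha
  refine hw0 (funext fun i => ?_)
  have h3 := (Finset.sum_eq_zero_iff_of_nonneg fun i _ => sq_nonneg (w i)).1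
    (le_antisymm h2 (Finset.sum_nonneg fun i _ => sq_nonneg (w i))) i (Finset.mem_univ i)
  simpa using h3

/-- The law of a nearly isometric linear image of a standard Gaussian vector is comparable with
isotropic Gaussian laws. -/
lemma pi_gaussianReal_preimage_le {a b : NNReal} (ha : a ≠ 0) (hb : b ≠ 0)
    (h₁ : ∀ w, a * ∑ i, w i ^ 2 ≤ ∑ i, T w i ^ 2)
    (h₂ : ∀ w, ∑ i, T w i ^ 2 ≤ b * ∑ i, w i ^ 2) {E : Set (ι → ℝ)} (hE : MeasurableSet E) :
    (Measure.pi (fun _ : ι => gaussianReal 0 1)).real (T ⁻¹' E) ≤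
      (√b / √a) ^ Fintype.card ι * (Measure.pi (fun _ : ι => gaussianReal 0 b)).real E := by
  have ha' : 0 < √(a : ℝ) := Real.sqrt_pos.2 (NNReal.coe_pos.2 (pos_iff_ne_zero.2 ha))
  have hT := det_ne_zero_of_le_sum_sq (NNReal.coe_pos.2 (pos_iff_ne_zero.2 ha)) h₁
  refine (pi_gaussianReal_preimage_le_aux hb hT h₂ hE).trans ?_
  have := le_pi_gaussianReal_preimage_aux ha hT h₁ MeasurableSet.univ
  simp only [Set.preimage_univ, probReal_univ, mul_one] at this
  rw [div_pow, div_eq_mul_inv]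
  gcongr
  rwa [← one_div (√(a : ℝ) ^ _), le_div_iff₀' (by positivity)]

lemma le_pi_gaussianReal_preimage {a b : NNReal} (ha : a ≠ 0) (hb : b ≠ 0)
    (h₁ : ∀ w, a * ∑ i, w i ^ 2 ≤ ∑ i, T w i ^ 2)
    (h₂ : ∀ w, ∑ i, T w i ^ 2 ≤ b * ∑ i, w i ^ 2) {E : Set (ι → ℝ)} (hE : MeasurableSet E) :
    (√a / √b) ^ Fintype.card ι * (Measure.pi (fun _ : ι => gaussianReal 0 a)).real E ≤
    (Measure.pi (fun _ : ι => gaussianReal 0 1)).real (T ⁻¹' E) := by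
  have hb' : 0 < √(b : ℝ) := Real.sqrt_pos.2 (NNReal.coe_pos.2 (pos_iff_ne_zero.2 hb))
  have hT := det_ne_zero_of_le_sum_sq (NNReal.coe_pos.2 (pos_iff_ne_zero.2 ha)) h₁
  refine le_trans ?_ (le_pi_gaussianReal_preimage_aux ha hT h₁ hE)
  have := pi_gaussianReal_preimage_le_aux hb hT h₂ MeasurableSet.univ
  simp only [Set.preimage_univ, probReal_univ, mul_one] at this
  rw [div_pow, div_eq_mul_inv]
  gcongr
  rwa [← one_div (√(b : ℝ) ^ _), div_le_iff₀' (by positivity)]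

end PiGaussian

section Comparison

open scoped Matrix MatrixOrder RealInnerProductSpace

/-- Two-sided tail of the standard Gaussian. -/
noncomputable def gaussianTail (z : ℝ) : ℝ := (gaussianReal 0 1).real {x | z < |x|}

lemma gaussianReal_abs_gt {v : NNReal} (hv : v ≠ 0) (z : ℝ) :
    (gaussianReal 0 v).real {x | z < |x|} = gaussianTail (z / √v) := by
  have hs : 0 < √(v : ℝ) := Real.sqrt_pos.2 (NNReal.coe_pos.2 (pos_iff_ne_zero.2 hv))
  have hset : MeasurableSet {x : ℝ | z < |x|} := measurableSet_lt measurable_const (by fun_prop)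
  have : gaussianReal 0 v = (gaussianReal 0 1).map (√(v : ℝ) * ·) := by
    rw [gaussianReal_map_const_mul]
    congr 1
    · simp
    · ext; simp
  rw [this, map_measureReal_apply (by fun_prop) hset, gaussianTail]
  congr 1
  ext x
  simp [abs_mul, abs_of_pos hs, div_lt_iff₀' hs]

variable {Ω ι : Type*} [MeasurableSpace Ω] {P : Measure Ω} [Fintype ι]
  {X : ι → Ω → ℝ}

namespace IsStdGaussianFamily

lemma abs_sum_cov_sub_le (h : IsStdGaussianFamily X P) {τ : ℝ} (hτ : 0 ≤ τ)
    (hcov : ∀ i j, i ≠ j → |cov[X i, X j; P]| ≤ τ) (w : ι → ℝ) :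
    |∑ i, ∑ j, w i * w j * cov[X i, X j; P] - ∑ i, w i ^ 2| ≤
      Fintype.card ι * τ * ∑ i, w i ^ 2 := by
  classical
  have h1 : ∑ i, w i ^ 2 = ∑ i, ∑ j, if i = j then w i * w j else 0 := by
    simp [sq]
  have h2 : Fintype.card ι * τ * ∑ i, w i ^ 2 =
      ∑ i : ι, ∑ j : ι, τ * ((w i ^ 2 + w j ^ 2) / 2) := by
    simp_rw [← Finset.mul_sum, ← Finset.sum_div, Finset.sum_add_distrib]
    simp only [Finset.sum_const, Finset.card_univ, nsmul_eq_mul, ← Finset.mul_sum]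
    ring
  rw [h2]
  nth_rewrite 1 [h1]
  simp_rw [← Finset.sum_sub_distrib]
  refine (Finset.abs_sum_le_sum_abs _ _).trans (Finset.sum_le_sum fun i _ =>
    (Finset.abs_sum_le_sum_abs _ _).trans (Finset.sum_le_sum fun j _ => ?_))
  by_cases hij : i = j
  · subst hij
    rw [covariance_self (h.meas i).aemeasurable, h.var]
    simp only [mul_one, if_true, sub_self, abs_zero]
    positivity
  · rw [if_neg hij, sub_zero, abs_mul, mul_comm]
    refine mul_le_mul (hcov i j hij) ?_ (abs_nonneg _) hτ
    rw [abs_mul]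
    nlinarith [sq_nonneg (|w i| - |w j|), sq_abs (w i), sq_abs (w j)]

variable [IsProbabilityMeasure P]

lemma exists_linearMap (h : IsStdGaussianFamily X P) :
    ∃ T : (ι → ℝ) →ₗ[ℝ] (ι → ℝ),
      (∀ w, ∑ i, T w i ^ 2 = ∑ i, ∑ j, w i * w j * cov[X i, X j; P]) ∧
      P.map (fun ω i => X i ω) = (Measure.pi (fun _ : ι => gaussianReal 0 1)).map T := by
  classical
  let S : Matrix ι ι ℝ := Matrix.of fun i j => cov[X i, X j; P]
  have hquad : ∀ w : ι → ℝ, w ⬝ᵥ S *ᵥ w = ∑ i, ∑ j, w i * w j * cov[X i, X j; P] := by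
    intro w
    simp only [dotProduct, Matrix.mulVec, S, Matrix.of_apply, Finset.mul_sum]
    exact Finset.sum_congr rfl fun i _ => Finset.sum_congr rfl fun j _ => by ring
  have hS : S.PosSemidef := by
    refine Matrix.PosSemidef.of_dotProduct_mulVec_nonneg ?_ fun w => ?_
    · ext i j
      simp [S, covariance_comm]
    · rw [star_trivial, hquad]
      exact h.sum_cov_nonneg w
  let B := CFC.sqrt S
  have hBB : B * B = S := CFC.sqrt_mul_sqrt_self S hS.nonneg
  have hBT : Bᵀ = B := by
    have := (CFC.sqrt_nonneg S).isSelfAdjoint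
    rwa [IsSelfAdjoint, Matrix.star_eq_conjTranspose, Matrix.conjTranspose_eq_transpose_of_trivial]
      at this
  refine ⟨B.mulVecLin, fun w => ?_, ?_⟩
  · rw [← hquad, ← hBB, ← Matrix.mulVec_mulVec, Matrix.dotProduct_mulVec, ← Matrix.mulVec_transpose,
      hBT]
    simp [dotProduct, sq]
  have hX : Measurable (fun ω i => X i ω) := measurable_pi_lambda _ h.meas
  have hXi := h.meas
  have hE : P.map (fun ω => WithLp.toLp 2 (fun i => X i ω)) = multivariateGaussian 0 S := by
    have hY : Measurable (fun ω => WithLp.toLp 2 (fun i => X i ω)) := by fun_prop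
    have : IsProbabilityMeasure (P.map (fun ω => WithLp.toLp 2 (fun i => X i ω))) :=
      Measure.isProbabilityMeasure_map hY.aemeasurable
    refine Measure.ext_of_charFun ?_
    ext t
    have hl := congrArg (fun μ => charFun μ 1) (h.map_sum t.ofLp)
    simp only [charFun_gaussianReal, Real.coe_toNNReal _ (h.sum_cov_nonneg _)] at hl
    rw [charFun_multivariateGaussian hS, hquad, charFun_apply, integral_map hY.aemeasurable
      (by fun_prop)]
    rw [charFun_apply, integral_map (Finset.measurable_fun_sum _ fun i _ =>
      (h.meas i).const_mul _).aemeasurable (by fun_prop)] at hl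
    simpa [PiLp.inner_apply] using hl
  calc P.map (fun ω i => X i ω)
      = (P.map (fun ω => WithLp.toLp 2 (fun i => X i ω))).map WithLp.ofLp := by
        rw [Measure.map_map (by fun_prop) (by fun_prop)]
        rfl
    _ = _ := by
        rw [hE, multivariateGaussian, ← map_pi_eq_stdGaussian, Measure.map_map (by fun_prop)
          (by fun_prop), Measure.map_map (by fun_prop) (by fun_prop)]
        congr 1
        ext x i
        simp [B]

lemma measure_forall_abs_gt_bounds (h : IsStdGaussianFamily X P) {τ : ℝ} (hτ : 0 ≤ τ)
    (hτ1 : Fintype.card ι * τ < 1)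
    (hcov : ∀ i j, i ≠ j → |cov[X i, X j; P]| ≤ τ) (z : ℝ) :
    P.real (⋂ i, {ω | z < |X i ω|}) ≤
      (√(1 + Fintype.card ι * τ) / √(1 - Fintype.card ι * τ)) ^ Fintype.card ι *
        gaussianTail (z / √(1 + Fintype.card ι * τ)) ^ Fintype.card ι ∧
    (√(1 - Fintype.card ι * τ) / √(1 + Fintype.card ι * τ)) ^ Fintype.card ι *
        gaussianTail (z / √(1 - Fintype.card ι * τ)) ^ Fintype.card ι ≤
      P.real (⋂ i, {ω | z < |X i ω|}) := by
  obtain ⟨T, hT, hmap⟩ := h.exists_linearMap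
  set m := Fintype.card ι * τ with hm
  have hm0 : 0 ≤ m := by positivity
  obtain ⟨a, ha⟩ : ∃ a : NNReal, (a : ℝ) = 1 - m := ⟨⟨1 - m, by linarith⟩, rfl⟩
  obtain ⟨b, hb⟩ : ∃ b : NNReal, (b : ℝ) = 1 + m := ⟨⟨1 + m, by linarith⟩, rfl⟩
  have ha0 : a ≠ 0 := by rw [← NNReal.coe_ne_zero, ha]; linarith
  have hb0 : b ≠ 0 := by rw [← NNReal.coe_ne_zero, hb]; linarith
  have h₁ : ∀ w, a * ∑ i, w i ^ 2 ≤ ∑ i, T w i ^ 2 := fun w => by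
    have := (abs_le.1 (h.abs_sum_cov_sub_le hτ hcov w)).1
    rw [hT, ha]; linarith
  have h₂ : ∀ w, ∑ i, T w i ^ 2 ≤ b * ∑ i, w i ^ 2 := fun w => by
    have := (abs_le.1 (h.abs_sum_cov_sub_le hτ hcov w)).2
    rw [hT, hb]; linarith
  let E : Set (ι → ℝ) := Set.univ.pi fun _ => {x | z < |x|}
  have hE : MeasurableSet E := MeasurableSet.univ_pi fun _ =>
    measurableSet_lt measurable_const (by fun_prop)
  have hX : Measurable (fun ω i => X i ω) := measurable_pi_lambda _ h.meas
  have hPE : P.real (⋂ i, {ω | z < |X i ω|}) =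
      (Measure.pi (fun _ : ι => gaussianReal 0 1)).real (T ⁻¹' E) := by
    rw [← map_measureReal_apply T.continuous_of_finiteDimensional.measurable hE, ← hmap,
      map_measureReal_apply hX hE]
    congr 1
    ext ω
    simp [E]
  have htail : ∀ v : NNReal, v ≠ 0 → (Measure.pi (fun _ : ι => gaussianReal 0 v)).real E =
      gaussianTail (z / √v) ^ Fintype.card ι := fun v hv => by
    rw [measureReal_def, Measure.pi_pi, ENNReal.toReal_prod, ← gaussianReal_abs_gt hv]
    simp [measureReal_def]
  rw [hPE, ← ha, ← hb, ← htail a ha0, ← htail b hb0]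
  exact ⟨pi_gaussianReal_preimage_le ha0 hb0 h₁ h₂ hE,
    le_pi_gaussianReal_preimage ha0 hb0 h₁ h₂ hE⟩

end IsStdGaussianFamily
end Comparison

section Tail

lemma gaussianTail_eq {x : ℝ} (hx : 0 < x) :
    gaussianTail x = 2 * ((√(2 * π))⁻¹ * ∫ t in Set.Ioi x, exp (-t ^ 2 / 2)) := by
  have hset : {t : ℝ | x < |t|} = Set.Ioi x ∪ (fun t => -t) ⁻¹' Set.Ioi x := by
    ext t; simp [lt_abs, lt_neg]
  have hdisj : Disjoint (Set.Ioi x) ((fun t : ℝ => -t) ⁻¹' Set.Ioi x) := by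
    rw [Set.disjoint_left]
    intro t ht ht'
    simp only [Set.mem_Ioi, Set.mem_preimage] at ht ht'
    linarith
  have hneg : (gaussianReal 0 1).real ((fun t : ℝ => -t) ⁻¹' Set.Ioi x) =
      (gaussianReal 0 1).real (Set.Ioi x) := by
    rw [← map_measureReal_apply measurable_neg measurableSet_Ioi, gaussianReal_map_neg, neg_zero]
  rw [gaussianTail, hset, measureReal_union hdisj (measurable_neg measurableSet_Ioi), hneg,
    ← two_mul]
  congr 1
  rw [measureReal_def, gaussianReal_apply_eq_integral 0 one_ne_zero, ENNReal.toReal_ofReal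
    (integral_nonneg fun t => gaussianPDFReal_nonneg 0 1 t), ← integral_const_mul]
  simp [gaussianPDFReal]

lemma integral_Ioi_exp_neg_sq_div_two {x : ℝ} (hx : 0 < x) :
    x * exp (x ^ 2 / 2) * ∫ t in Set.Ioi x, exp (-t ^ 2 / 2) =
      ∫ u in Set.Ioi (0 : ℝ), exp (-u) * exp (-(u ^ 2 / (2 * x ^ 2))) := by
  have h1 := integral_comp_mul_left_Ioi (fun t => exp (-t ^ 2 / 2)) (x ^ 2)
    (inv_pos.2 hx)
  have h2 := (measurePreserving_add_right volume (x ^ 2)).setIntegral_preimage_emb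
    (MeasurableEquiv.addRight (x ^ 2)).measurableEmbedding
    (fun t => exp (-(x⁻¹ * t) ^ 2 / 2)) (Set.Ioi (x ^ 2))
  have hpre : (fun t => t + x ^ 2) ⁻¹' Set.Ioi (x ^ 2) = Set.Ioi 0 := by ext t; simp
  rw [hpre, h1, inv_inv, smul_eq_mul, show x⁻¹ * x ^ 2 = x by field_simp] at h2
  rw [mul_right_comm, ← h2, ← integral_mul_const]
  refine integral_congr_ae (ae_of_all _ fun u => ?_)
  simp only [← exp_add]
  congr 1
  field_simp
  ring

lemma tendsto_gaussianTail_mul :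
    Tendsto (fun x => x * exp (x ^ 2 / 2) * gaussianTail x) atTop (nhds (√(2 / π))) := by
  have hlim : Tendsto
      (fun x : ℝ => ∫ u in Set.Ioi (0 : ℝ), exp (-u) * exp (-(u ^ 2 / (2 * x ^ 2))))
      atTop (nhds 1) := by
    rw [← integral_exp_neg_Ioi_zero]
    refine tendsto_integral_filter_of_dominated_convergence (fun u => exp (-u)) ?_ ?_
      (integrableOn_exp_neg_Ioi 0) ?_
    · exact Eventually.of_forall fun x => by fun_prop
    · refine Eventually.of_forall fun x => ae_of_all _ fun u => ?_
      rw [norm_of_nonneg (by positivity)]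
      refine mul_le_of_le_one_right (exp_pos _).le (exp_le_one_iff.2 ?_)
      have : 0 ≤ u ^ 2 / (2 * x ^ 2) := by positivity
      linarith
    · refine ae_of_all _ fun u => ?_
      have h : Tendsto (fun x : ℝ => -(u ^ 2 / (2 * x ^ 2))) atTop (nhds 0) := by
        rw [← neg_zero]
        exact (tendsto_const_nhds.div_atTop
          ((tendsto_pow_atTop two_ne_zero).const_mul_atTop two_pos)).neg
      simpa using ((continuous_exp.tendsto 0).comp h).const_mul (exp (-u))
  have hc : √(2 / π) = 2 * (√(2 * π))⁻¹ := by
    rw [Real.sqrt_div two_pos.le, Real.sqrt_mul two_pos.le]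
    have : √2 * √2 = (2 : ℝ) := Real.mul_self_sqrt two_pos.le
    have : √2 ≠ 0 := by positivity
    have : √π ≠ 0 := by positivity
    field_simp
    linarith
  have := hlim.const_mul (2 * (√(2 * π))⁻¹)
  rw [mul_one, ← hc] at this
  refine this.congr' ?_
  filter_upwards [eventually_gt_atTop 0] with x hx
  rw [gaussianTail_eq hx, ← integral_Ioi_exp_neg_sq_div_two hx, hc]
  ring

variable {s : ℕ → ℕ} {ζ : ℕ → ℝ} {z : ℝ}

lemma tendsto_sq_div_log (hs : Tendsto s atTop atTop)
    (hζ : Tendsto (fun n => ζ n ^ 2 -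
      (2 * log (s n) - log (log (s n)) - log π + 2 * z)) atTop (nhds 0)) :
    Tendsto (fun n => ζ n ^ 2 / log (s n)) atTop (nhds 2) := by
  have hl : Tendsto (fun n => log (s n)) atTop atTop :=
    tendsto_log_atTop.comp (tendsto_natCast_atTop_atTop.comp hs)
  have h1 : Tendsto (fun n => log (log (s n)) / log (s n)) atTop (nhds 0) :=
    (isLittleO_log_id_atTop.tendsto_div_nhds_zero).comp hl
  have h2 := (hζ.div_atTop hl).sub h1
  have h3 := (h2.add ((tendsto_const_nhds (x := 2 * z - log π)).div_atTop hl)).add_const 2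
  simp only [sub_zero, zero_add] at h3
  refine h3.congr' ?_
  filter_upwards [hl.eventually_gt_atTop 0] with n hn
  field_simp
  ring

lemma tendsto_mul_gaussianTail (hs : Tendsto s atTop atTop) (hpos : ∀ᶠ n in atTop, 0 < ζ n)
    (hζ : Tendsto (fun n => ζ n ^ 2 -
      (2 * log (s n) - log (log (s n)) - log π + 2 * z)) atTop (nhds 0)) :
    Tendsto (fun n => s n * gaussianTail (ζ n)) atTop (nhds (exp (-z))) := by
  have hl : Tendsto (fun n => log (s n)) atTop atTop :=
    tendsto_log_atTop.comp (tendsto_natCast_atTop_atTop.comp hs)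
  have hr := tendsto_sq_div_log hs hζ
  have hsq : Tendsto (fun n => ζ n ^ 2) atTop atTop := by
    refine (hr.pos_mul_atTop two_pos hl).congr' ?_
    filter_upwards [hl.eventually_gt_atTop 0] with n hn
    field_simp
  have hζtop : Tendsto ζ atTop atTop := by
    refine (tendsto_sqrt_atTop.comp hsq).congr' ?_
    filter_upwards [hpos] with n hn
    exact Real.sqrt_sq hn.le
  have hA := tendsto_gaussianTail_mul.comp hζtop
  have hB : Tendsto (fun n => log (s n) - ζ n ^ 2 / 2 - log (ζ n)) atTop
      (nhds (log π / 2 - z - log 2 / 2)) := by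
    have h1 := (hr.log two_ne_zero).div_const 2
    have h2 := ((hζ.div_const 2).neg.add_const (log π / 2 - z)).sub h1
    rw [show -(0 / 2) + (log π / 2 - z) - log 2 / 2 = log π / 2 - z - log 2 / 2 by ring] at h2
    refine h2.congr' ?_
    filter_upwards [hl.eventually_gt_atTop 0, hpos] with n hn hp
    rw [log_div (by positivity) hn.ne', log_pow]
    push_cast
    ring
  have hC := ((continuous_exp.tendsto _).comp hB).mul hA
  have hval : exp (log π / 2 - z - log 2 / 2) * √(2 / π) = exp (-z) := by
    have : √(2 / π) = exp ((log 2 - log π) / 2) := by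
      rw [← log_div two_ne_zero pi_pos.ne', Real.sqrt_eq_rpow, Real.rpow_def_of_pos (by positivity)]
      ring_nf
    rw [this, ← exp_add]
    ring_nf
  rw [hval] at hC
  refine hC.congr' ?_
  filter_upwards [hpos, hs.eventually_gt_atTop 0] with n hp hsn
  have hs0 : (0 : ℝ) < s n := by exact_mod_cast hsn
  simp only [Function.comp]
  rw [exp_sub, exp_sub, exp_log hs0, exp_log hp]
  field_simp

/-- Rescaling the threshold by a factor `√(1 + t / log sₙ)` shifts `z` by `t`. -/
lemma tendsto_mul_gaussianTail_div_sqrt (hs : Tendsto s atTop atTop) (hpos : ∀ n, 0 < ζ n)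
    (hζ : Tendsto (fun n => ζ n ^ 2 -
      (2 * log (s n) - log (log (s n)) - log π + 2 * z)) atTop (nhds 0)) (t : ℝ) :
    Tendsto (fun n => s n * gaussianTail (ζ n / √(1 + t / log (s n)))) atTop
      (nhds (exp (-(z - t)))) := by
  have hl : Tendsto (fun n => log (s n)) atTop atTop :=
    tendsto_log_atTop.comp (tendsto_natCast_atTop_atTop.comp hs)
  have h1 : Tendsto (fun n => 1 + t / log (s n)) atTop (nhds 1) := by
    simpa using (tendsto_const_nhds (x := t)).div_atTop hl |>.const_add 1
  have hp1 := h1.eventually (lt_mem_nhds one_pos)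
  refine tendsto_mul_gaussianTail hs ?_ ?_
  · filter_upwards [hp1] with n hn
    exact div_pos (hpos n) (Real.sqrt_pos.2 hn)
  · have h2 := (((tendsto_sq_div_log hs hζ).mul_const t).div h1 one_ne_zero)
    have h3 := (hζ.sub h2).add_const (2 * t)
    rw [show (0 : ℝ) - 2 * t / 1 + 2 * t = 0 by ring] at h3
    refine h3.congr' ?_
    filter_upwards [hp1, hl.eventually_gt_atTop 0] with n hn hln
    rw [div_pow, Real.sq_sqrt hn.le]
    have : log (s n) + t ≠ 0 := by
      have : 1 + t / log (s n) = (log (s n) + t) / log (s n) := by field_simp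
      rw [this] at hn
      exact fun h0 => by simp [h0] at hn
    simp only [Pi.div_apply]
    have h4 : ζ n ^ 2 / (1 + t / log (s n)) =
      ζ n ^ 2 - ζ n ^ 2 / log (s n) * t / (1 + t / log (s n)) := by
      field_simp
      ring
    rw [h4]
    ring

end Tail

section Clusters

variable {V : Type*} [Fintype V] [DecidableEq V] (R : V → V → Prop) [DecidableRel R]

/-- The set of all points related to some point of `S`. -/
def relNbhd (S : Finset V) : Finset V := S.biUnion fun i => Finset.univ.filter (R i)

variable {R}

lemma mem_relNbhd {S : Finset V} {j : V} : j ∈ relNbhd R S ↔ ∃ i ∈ S, R i j := by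
  simp [relNbhd]

lemma card_iterate_relNbhd_le {D : ℝ} (hD : 0 ≤ D)
    (h : ∀ i, ((Finset.univ.filter (R i)).card : ℝ) ≤ D) (S : Finset V) (k : ℕ) :
    (((relNbhd R)^[k] S).card : ℝ) ≤ S.card * D ^ k := by
  induction k with
  | zero => simp
  | succ k ih =>
    rw [Function.iterate_succ_apply']
    calc ((relNbhd R ((relNbhd R)^[k] S)).card : ℝ)
        ≤ ∑ i ∈ (relNbhd R)^[k] S, ((Finset.univ.filter (R i)).card : ℝ) := by
          exact_mod_cast Finset.card_biUnion_le
      _ ≤ ((relNbhd R)^[k] S).card * D := by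
          simpa using Finset.sum_le_card_nsmul _ _ D fun i _ => h i
      _ ≤ S.card * D ^ k * D := by gcongr
      _ = S.card * D ^ (k + 1) := by ring

lemma subset_iterate_relNbhd (hrefl : ∀ i, R i i) (S : Finset V) {k l : ℕ} (hkl : k ≤ l) :
    (relNbhd R)^[k] S ⊆ (relNbhd R)^[l] S := by
  induction l, hkl using Nat.le_induction with
  | base => exact subset_rfl
  | succ l _ ih =>
    rw [Function.iterate_succ_apply']
    exact ih.trans fun i hi => mem_relNbhd.2 ⟨i, hi, hrefl i⟩

/-- In a finite set with a related pair `a, b`, one can choose one representative for each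
connected component, with `a` among them. -/
lemma exists_cluster_representatives (hrefl : ∀ i, R i i) (hsymm : ∀ i j, R i j → R j i)
    {A : Finset V} {a b : V} (ha : a ∈ A) (hb : b ∈ A) (hab : a ≠ b) (hR : R a b) :
    ∃ S ⊆ A, a ∈ S ∧ b ∉ S ∧ (∀ x ∈ S, ∀ y ∈ S, x ≠ y → ¬ R x y) ∧
      (∀ x ∈ S, x ≠ a → ¬ R x b) ∧ A ⊆ (relNbhd R)^[A.card] S := by
  classical
  let G : SimpleGraph A := SimpleGraph.fromRel fun x y => R x y
  have hadj : ∀ x y : A, G.Adj x y ↔ x ≠ y ∧ R x y := fun x y => by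
    simp only [G, SimpleGraph.fromRel_adj]
    exact and_congr_right fun _ => ⟨fun h => h.elim id (hsymm _ _), Or.inl⟩
  let rep : A → A := fun v =>
    if G.Reachable ⟨a, ha⟩ v then ⟨a, ha⟩ else (G.connectedComponentMk v).out
  have hrep : ∀ v, G.Reachable (rep v) v := by
    intro v
    by_cases hv : G.Reachable ⟨a, ha⟩ v
    · simp only [rep, if_pos hv]; exact hv
    · simp only [rep, if_neg hv]
      exact SimpleGraph.ConnectedComponent.exact (Quot.out_eq _)
  have hconst : ∀ x y, G.Reachable x y → rep x = rep y := by
    intro x y hxy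
    have h1 : G.connectedComponentMk x = G.connectedComponentMk y :=
      SimpleGraph.ConnectedComponent.sound hxy
    have h2 : G.Reachable ⟨a, ha⟩ x ↔ G.Reachable ⟨a, ha⟩ y :=
      ⟨fun h => h.trans hxy, fun h => h.trans hxy.symm⟩
    simp only [rep, h1, h2]
  have hfix : ∀ v, rep (rep v) = rep v := fun v => hconst _ _ (hrep v)
  have hrepa : rep ⟨a, ha⟩ = ⟨a, ha⟩ := if_pos (SimpleGraph.Reachable.refl _)
  have hind : ∀ x y : A, rep x = x → rep y = y → x ≠ y → ¬ R x y := by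
    intro x y hx hy hxy h
    exact hxy (hx ▸ hy ▸ hconst x y ((hadj x y).2 ⟨hxy, h⟩).reachable)
  have hrepb : rep ⟨b, hb⟩ = ⟨a, ha⟩ := by
    rw [← hrepa]
    exact (hconst _ _ ((hadj ⟨a, ha⟩ ⟨b, hb⟩).2 ⟨by simpa using hab, hR⟩).reachable).symm
  let S : Finset V := Finset.univ.image fun v => (rep v : V)
  have hmem : ∀ x, x ∈ S ↔ ∃ hx : x ∈ A, rep ⟨x, hx⟩ = ⟨x, hx⟩ := by
    intro x
    simp only [S, Finset.mem_image, Finset.mem_univ, true_and]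
    constructor
    · rintro ⟨v, rfl⟩
      exact ⟨(rep v).2, hfix v⟩
    · rintro ⟨hx, h⟩
      exact ⟨⟨x, hx⟩, by rw [h]⟩
  refine ⟨S, fun x hx => ((hmem x).1 hx).1, (hmem a).2 ⟨ha, hrepa⟩, ?_, ?_, ?_, ?_⟩
  · intro hbS
    obtain ⟨_, h⟩ := (hmem b).1 hbS
    rw [hrepb] at h
    exact hab (congrArg Subtype.val h)
  · intro x hx y hy hxy
    obtain ⟨hxA, hx⟩ := (hmem x).1 hx
    obtain ⟨hyA, hy⟩ := (hmem y).1 hy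
    exact hind ⟨x, hxA⟩ ⟨y, hyA⟩ hx hy (by simpa using hxy)
  · intro x hx hxa h
    obtain ⟨hxA, hx⟩ := (hmem x).1 hx
    by_cases hxb : x = b
    · subst hxb
      rw [hrepb] at hx
      exact hab (congrArg Subtype.val hx)
    · have := hconst ⟨x, hxA⟩ ⟨b, hb⟩ ((hadj _ _).2 ⟨by simpa using hxb, h⟩).reachable
      rw [hx, hrepb] at this
      exact hxa (congrArg Subtype.val this)
  · intro v hv
    have hwalk : ∀ (x y : A) (p : G.Walk x y), (x : V) ∈ S →
        (y : V) ∈ (relNbhd R)^[p.length] S := by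
      intro x y p hx
      induction p using SimpleGraph.Walk.concatRec with
      | Hnil => simpa using hx
      | Hconcat p h ih =>
        rw [SimpleGraph.Walk.length_concat, Function.iterate_succ_apply']
        exact mem_relNbhd.2 ⟨_, ih hx, ((hadj _ _).1 h).2⟩
    obtain ⟨p, hp⟩ := (hrep ⟨v, hv⟩).exists_isPath
    have hlen : p.length ≤ A.card := by
      have := hp.length_lt
      rw [Fintype.card_coe] at this
      exact this.le
    exact subset_iterate_relNbhd hrefl S hlen
      (hwalk _ _ p ((hmem _).2 ⟨(rep ⟨v, hv⟩).2, hfix _⟩))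

end Clusters

section Counting

variable {V : Type*} [Fintype V] [DecidableEq V]

/-- The `d`-subsets containing a pair from `E` number at most `|E| |V| ^ (d - 2)`. -/
lemma card_powersetCard_filter_pair_le (E : Finset (V × V)) (hE : ∀ p ∈ E, p.1 ≠ p.2) (d : ℕ) :
    (((Finset.univ.powersetCard d).filter fun A : Finset V =>
      ∃ p ∈ E, p.1 ∈ A ∧ p.2 ∈ A).card : ℝ) * (Fintype.card V : ℝ) ^ 2 ≤
      E.card * (Fintype.card V : ℝ) ^ d := by
  by_cases hd : d < 2
  · rw [Finset.card_eq_zero.2]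
    · simp only [Nat.cast_zero, zero_mul]; positivity
    · refine Finset.filter_eq_empty_iff.2 fun A hA => ?_
      rintro ⟨p, hp, h1, h2⟩
      have := Finset.one_lt_card.2 ⟨p.1, h1, p.2, h2, hE p hp⟩
      rw [(Finset.mem_powersetCard.1 hA).2] at this
      omega
  · obtain ⟨k, rfl⟩ := Nat.exists_eq_add_of_le' (not_lt.1 hd)
    have hsub : ((Finset.univ.powersetCard (k + 2)).filter fun A : Finset V =>
        ∃ p ∈ E, p.1 ∈ A ∧ p.2 ∈ A) ⊆
        (E ×ˢ (Finset.univ.powersetCard k : Finset (Finset V))).image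
          fun q => insert q.1.1 (insert q.1.2 q.2) := by
      intro A hA
      obtain ⟨hA, p, hp, h1, h2⟩ := Finset.mem_filter.1 hA
      refine Finset.mem_image.2 ⟨(p, (A.erase p.1).erase p.2), ?_, ?_⟩
      · refine Finset.mem_product.2 ⟨hp, Finset.mem_powersetCard.2 ⟨Finset.subset_univ _, ?_⟩⟩
        have h2' : p.2 ∈ A.erase p.1 := Finset.mem_erase.2 ⟨(hE p hp).symm, h2⟩
        rw [Finset.card_erase_of_mem h2', Finset.card_erase_of_mem h1,
          (Finset.mem_powersetCard.1 hA).2]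
        rfl
      · have h2' : p.2 ∈ A.erase p.1 := Finset.mem_erase.2 ⟨(hE p hp).symm, h2⟩
        simp only
        rw [Finset.insert_erase h2', Finset.insert_erase h1]
    have hc := (Finset.card_le_card hsub).trans Finset.card_image_le
    rw [Finset.card_product, Finset.card_powersetCard, Finset.card_univ] at hc
    have hc' := hc.trans (Nat.mul_le_mul_left _ (Nat.choose_le_pow (Fintype.card V) k))
    calc _ ≤ (E.card * (Fintype.card V : ℝ) ^ k) * (Fintype.card V : ℝ) ^ 2 := by
            gcongr
            exact_mod_cast hc'
      _ = _ := by ring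

end Counting

section Conditions

variable {s : ℕ → ℕ} {r : ∀ n, Fin (s n) → Fin (s n) → ℝ}

lemma le_gammafun (hr : ∀ n i j, |r n i j| ≤ 1) {n : ℕ} {i : Fin (s n)} {A : Finset (Fin (s n))}
    (hA : A.Nonempty) {ε : ℝ} (h : ∀ j ∈ A, ε ≤ |r n i j|) : ε ≤ gammafun s r n A.card := by
  refine le_csSup_of_le ⟨1, ?_⟩ ⟨i, A, rfl, rfl⟩
    (le_csInf ((Finset.coe_nonempty.2 hA).image _) ?_)
  · rintro x ⟨i, B, -, rfl⟩
    obtain rfl | ⟨j, hj⟩ := B.eq_empty_or_nonempty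
    · simp
    · refine (csInf_le ?_ (Set.mem_image_of_mem _ hj)).trans (hr n i j)
      exact ⟨0, by rintro _ ⟨k, -, rfl⟩; exact abs_nonneg _⟩
  · rintro _ ⟨j, hj, rfl⟩
    exact h j hj

lemma card_filter_lt_of_gammafun_lt (hr : ∀ n i j, |r n i j| ≤ 1) {n b : ℕ} (hb : 0 < b) {ε : ℝ}
    (h : gammafun s r n b < ε) (i : Fin (s n)) :
    (Finset.univ.filter fun j => ε < |r n i j|).card < b := by
  by_contra! hc
  obtain ⟨A, hA, rfl⟩ := Finset.exists_subset_card_eq hc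
  exact h.not_ge (le_gammafun hr (Finset.card_pos.1 hb) fun j hj =>
    (Finset.mem_filter.1 (hA hj)).2.le)

lemma eventually_abs_le_of_limsup_gammamax_lt (hr : ∀ n i j, |r n i j| ≤ 1)
    (h : limsup (fun n => gammamax s r n) atTop < 1) :
    ∃ ρ : ℝ, 0 ≤ ρ ∧ ρ < 1 ∧ ∀ᶠ n in atTop, ∀ i j, i ≠ j → |r n i j| ≤ ρ := by
  obtain ⟨ρ, hρ, hρ1⟩ := exists_between (max_lt h one_pos)
  refine ⟨ρ, ((le_max_right _ _).trans_lt hρ).le, hρ1, ?_⟩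
  have hb : ∀ n, ∀ x ∈ {x : ℝ | ∃ i j : Fin (s n), i ≠ j ∧ x = |r n i j|}, x ≤ 1 := by
    rintro n _ ⟨i, j, -, rfl⟩
    exact hr n i j
  have hbdd : IsBoundedUnder (· ≤ ·) atTop (fun n => gammamax s r n) :=
    isBoundedUnder_of ⟨1, fun n => Real.sSup_le (hb n) zero_le_one⟩
  filter_upwards [eventually_lt_of_limsup_lt ((le_max_left _ _).trans_lt hρ) hbdd]
    with n hn i j hij
  exact (le_csSup ⟨1, hb n⟩ ⟨i, j, hij, rfl⟩).trans hn.le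

lemma tendsto_floor_rpow_add_one (hs : Tendsto s atTop atTop) {η : ℝ} (hη : 0 < η) :
    Tendsto (fun n => ⌊(s n : ℝ) ^ η⌋₊ + 1) atTop atTop :=
  (tendsto_add_atTop_nat 1).comp (tendsto_nat_floor_atTop.comp
    ((tendsto_rpow_atTop hη).comp (tendsto_natCast_atTop_atTop.comp hs)))

lemma CondB1.tendsto_gammafun (h : CondB1 s r) {b : ℕ → ℕ} (hb : Tendsto b atTop atTop) :
    Tendsto (fun n => gammafun s r n (b n)) atTop (nhds 0) := by
  refine (h.1 b hb).isBigO.trans_tendsto ?_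
  simp only [one_div]
  exact tendsto_inv_atTop_zero.comp
    (tendsto_log_atTop.comp (tendsto_natCast_atTop_atTop.comp hb))

lemma eventually_card_filter_le (hs : Tendsto s atTop atTop) (hr : ∀ n i j, |r n i j| ≤ 1)
    (hB : CondB1 s r ∨ CondB2 s r) {ε η : ℝ} (hε : 0 < ε) (hη : 0 < η) :
    ∀ᶠ n in atTop, ∀ i,
      ((Finset.univ.filter fun j => ε < |r n i j|).card : ℝ) ≤ (s n : ℝ) ^ η := by
  have hb := tendsto_floor_rpow_add_one hs hη
  have hγ := hB.elim (fun h => h.tendsto_gammafun hb) fun h => h.1 _ hb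
  filter_upwards [hγ.eventually_lt_const hε] with n hn i
  have := card_filter_lt_of_gammafun_lt hr (Nat.succ_pos _) hn i
  exact (Nat.cast_le.2 (Nat.lt_succ_iff.1 this)).trans (Nat.floor_le (by positivity))

/-- The number of pairs whose correlation exceeds `δ / log sₙ`. -/
lemma CondB1.eventually_card_pairs_le (h : CondB1 s r) (hs : Tendsto s atTop atTop)
    (hr : ∀ n i j, |r n i j| ≤ 1) {δ : ℝ} (hδ : 0 < δ) :
    ∀ᶠ n in atTop, ((Finset.univ.filter fun p : Fin (s n) × Fin (s n) =>
      p.1 ≠ p.2 ∧ δ / log (s n) < |r n p.1 p.2|).card : ℝ) ≤ (s n : ℝ) ^ (2 - 1 / 2 : ℝ) := by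
  have hb := tendsto_floor_rpow_add_one hs one_half_pos
  have hlog := tendsto_log_atTop.comp (tendsto_natCast_atTop_atTop.comp hs)
  have hlogb := tendsto_log_atTop.comp (tendsto_natCast_atTop_atTop.comp hb)
  filter_upwards [(h.1 _ hb).def (show 0 < δ / 4 by positivity), hlog.eventually_gt_atTop 0,
    hlogb.eventually_gt_atTop 0, hs.eventually_gt_atTop 0] with n hn hl hlb hs0
  simp only [Function.comp_apply] at hl hlb
  have hs0' : (0 : ℝ) < s n := by exact_mod_cast hs0
  have hle : log (s n) / 2 ≤ log ((⌊(s n : ℝ) ^ (1 / 2 : ℝ)⌋₊ + 1 : ℕ) : ℝ) := by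
    rw [show log (s n) / 2 = log ((s n : ℝ) ^ (1 / 2 : ℝ)) by rw [log_rpow hs0']; ring]
    refine log_le_log (by positivity) ?_
    push_cast
    exact (Nat.lt_floor_add_one _).le
  have hlt : gammafun s r n (⌊(s n : ℝ) ^ (1 / 2 : ℝ)⌋₊ + 1) < δ / log (s n) := by
    refine (le_abs_self _).trans_lt (hn.trans_lt ?_)
    rw [norm_of_nonneg (one_div_nonneg.2 hlb.le), mul_one_div, div_lt_div_iff₀ hlb hl]
    nlinarith
  have hrow : ∀ i : Fin (s n), ((Finset.univ.filter fun j => δ / log (s n) < |r n i j|).card : ℝ)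
      ≤ (s n : ℝ) ^ (1 / 2 : ℝ) := fun i =>
    (Nat.cast_le.2 (Nat.lt_succ_iff.1
      (card_filter_lt_of_gammafun_lt hr (Nat.succ_pos _) hlt i))).trans
      (Nat.floor_le (by positivity))
  calc _ ≤ ((Finset.univ.filter fun p : Fin (s n) × Fin (s n) =>
        δ / log (s n) < |r n p.1 p.2|).card : ℝ) := by
        exact_mod_cast Finset.card_le_card fun p hp => by
          simp only [Finset.mem_filter] at hp ⊢; exact ⟨hp.1, hp.2.2⟩
    _ = ∑ i : Fin (s n), ((Finset.univ.filter fun j => δ / log (s n) < |r n i j|).card : ℝ) := by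
        simp only [Finset.card_filter, Fintype.sum_prod_type, Nat.cast_sum]
    _ ≤ ∑ _i : Fin (s n), (s n : ℝ) ^ (1 / 2 : ℝ) := Finset.sum_le_sum fun i _ => hrow i
    _ = (s n : ℝ) ^ (2 - 1 / 2 : ℝ) := by
        rw [Finset.sum_const, Finset.card_univ, Fintype.card_fin, nsmul_eq_mul,
          show (2 - 1 / 2 : ℝ) = 1 + 1 / 2 by norm_num, rpow_add hs0', rpow_one]

lemma CondB2.eventually_card_pairs_le (h : CondB2 s r) (hs : Tendsto s atTop atTop) :
    ∃ κ : ℝ, 0 < κ ∧ ∀ δ : ℝ, 0 < δ →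
    ∀ᶠ n in atTop, ((Finset.univ.filter fun p : Fin (s n) × Fin (s n) =>
      p.1 ≠ p.2 ∧ δ / log (s n) < |r n p.1 p.2|).card : ℝ) ≤ (s n : ℝ) ^ (2 - κ : ℝ) := by
  obtain ⟨-, ⟨κ, hκ, hO⟩, -⟩ := h
  obtain ⟨C, hC, hO⟩ := hO.exists_pos
  refine ⟨κ / 2, half_pos hκ, fun δ hδ => ?_⟩
  have hcast : Tendsto (fun n => (s n : ℝ)) atTop atTop := tendsto_natCast_atTop_atTop.comp hs
  have hlog := tendsto_log_atTop.comp hcast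
  have hsmall := ((isLittleO_pow_log_id_atTop (n := 2)).comp_tendsto
    ((tendsto_rpow_atTop (half_pos hκ)).comp hcast)).def
    (show 0 < δ ^ 2 * (κ / 2) ^ 2 / C by positivity)
  filter_upwards [hO.bound, hlog.eventually_gt_atTop 0, hs.eventually_gt_atTop 0, hsmall]
    with n hn hl hs0 hsm
  simp only [Function.comp_apply, id] at hl hsm
  have hs0' : (0 : ℝ) < s n := by exact_mod_cast hs0
  set E := Finset.univ.filter fun p : Fin (s n) × Fin (s n) =>
      p.1 ≠ p.2 ∧ δ / log (s n) < |r n p.1 p.2|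
  have h1 : (E.card : ℝ) * (δ / log (s n)) ^ 2 ≤
      ∑ i : Fin (s n), ∑ j : Fin (s n), if i ≠ j then (r n i j) ^ 2 else 0 := by
    rw [← Fintype.sum_prod_type' (f := fun i j : Fin (s n) => if i ≠ j then (r n i j) ^ 2 else 0),
      ← nsmul_eq_mul, ← Finset.sum_const]
    refine (Finset.sum_le_sum fun p hp => ?_).trans
      (Finset.sum_le_sum_of_subset_of_nonneg (Finset.subset_univ E) fun p _ _ => ?_)
    · have hp := (Finset.mem_filter.1 hp).2
      rw [if_pos hp.1, ← sq_abs (r n p.1 p.2)]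
      exact pow_le_pow_left₀ (by positivity) hp.2.le 2
    · split_ifs <;> positivity
  have h2 := h1.trans ((le_abs_self _).trans hn)
  rw [norm_of_nonneg (by positivity)] at h2
  rw [log_rpow hs0', norm_of_nonneg (by positivity), norm_of_nonneg (by positivity)] at hsm
  have h3 : log (s n) ^ 2 * C ≤ δ ^ 2 * (s n : ℝ) ^ (κ / 2) := by
    rw [mul_pow, ← mul_div_right_comm, le_div_iff₀ hC] at hsm
    have : 0 < (κ / 2) ^ 2 := by positivity
    nlinarith
  have h4 : (s n : ℝ) ^ (2 - κ / 2) = (s n : ℝ) ^ (2 - κ) * (s n : ℝ) ^ (κ / 2) := by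
    rw [← rpow_add hs0']; ring_nf
  rw [h4]
  rw [div_pow, mul_div_assoc', div_le_iff₀ (by positivity)] at h2
  have h5 : (0 : ℝ) < (s n : ℝ) ^ (2 - κ) := by positivity
  have h6 : 0 < δ ^ 2 := by positivity
  nlinarith [mul_le_mul_of_nonneg_left h3 h5.le]

end Conditions

section PairCount

variable {V : Type*} [Fintype V] [DecidableEq V]

lemma card_powersetCard_filter_lt_le {c : V → V → ℝ} {τ e : ℝ} (he : 0 ≤ e)
    (hE : ((Finset.univ.filter fun p : V × V => p.1 ≠ p.2 ∧ τ < c p.1 p.2).card : ℝ) ≤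
      Fintype.card V ^ 2 * e) (d : ℕ) :
    (((Finset.univ.powersetCard d).filter fun A : Finset V =>
      ∃ i ∈ A, ∃ j ∈ A, i ≠ j ∧ τ < c i j).card : ℝ) ≤ Fintype.card V ^ d * e := by
  have key := card_powersetCard_filter_pair_le
    (Finset.univ.filter fun p : V × V => p.1 ≠ p.2 ∧ τ < c p.1 p.2)
    (fun p hp => (Finset.mem_filter.1 hp).2.1) d
  set E := Finset.univ.filter fun p : V × V => p.1 ≠ p.2 ∧ τ < c p.1 p.2
  have heq : ((Finset.univ.powersetCard d).filter fun A : Finset V =>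
      ∃ i ∈ A, ∃ j ∈ A, i ≠ j ∧ τ < c i j) =
      (Finset.univ.powersetCard d).filter fun A : Finset V => ∃ p ∈ E, p.1 ∈ A ∧ p.2 ∈ A := by
    refine Finset.filter_congr fun A _ => ⟨?_, ?_⟩
    · rintro ⟨i, hi, j, hj, hij⟩
      exact ⟨(i, j), Finset.mem_filter.2 ⟨Finset.mem_univ _, hij⟩, hi, hj⟩
    · rintro ⟨p, hp, hi, hj⟩
      exact ⟨p.1, hi, p.2, hj, (Finset.mem_filter.1 hp).2⟩
  rw [heq]
  obtain hV | hV := isEmpty_or_nonempty V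
  · rw [Finset.card_eq_zero.2 (Finset.filter_eq_empty_iff.2 fun A _ ⟨p, _⟩ => hV.false p.1)]
    simp only [Nat.cast_zero]
    positivity
  · have hN : (0 : ℝ) < Fintype.card V ^ 2 := by
      have : 0 < Fintype.card V := Fintype.card_pos
      positivity
    refine le_of_mul_le_mul_right (key.trans ?_) hN
    calc _ ≤ (Fintype.card V ^ 2 * e) * (Fintype.card V : ℝ) ^ d := by gcongr
      _ = _ := by ring

end PairCount

section BadSets

variable {Ω V : Type*} [MeasurableSpace Ω] {P : Measure Ω} [Fintype V] [DecidableEq V]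
  [IsProbabilityMeasure P] {X : V → Ω → ℝ}

namespace IsStdGaussianFamily

lemma measure_biInter_abs_gt_le (h : IsStdGaussianFamily X P) (A : Finset V) (z : ℝ) {u : V → ℝ}
    (hu : ∀ i, 0 ≤ u i) :
    P.real (⋂ i ∈ A, {ω | z < |X i ω|}) ≤ 2 ^ A.card *
      exp (-(z * ∑ i ∈ A, u i) + (∑ i ∈ A, ∑ j ∈ A, u i * u j * |cov[X i, X j; P]|) / 2) := by
  have := (h.subfamily A).measure_forall_abs_gt_le z (u := fun i : A => u i) fun i => hu i
  rw [Fintype.card_coe, Finset.sum_coe_sort A u,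
    Finset.sum_coe_sort A fun i => ∑ j : A, u i * u j * |cov[X i, X j; P]|] at this
  simp_rw [fun i => Finset.sum_coe_sort A fun j => u i * u j * |cov[X i, X j; P]|] at this
  have hA : (⋂ i ∈ A, {ω | z < |X i ω|}) = ⋂ i : A, {ω | z < |X i ω|} := by ext; simp
  rwa [hA]

lemma measure_biInter_abs_gt_le_of_abs_cov_le (h : IsStdGaussianFamily X P) {A : Finset V} {z ε : ℝ}
    (hz : 0 ≤ z) (hε : 0 ≤ ε)
    (hA : ∀ i ∈ A, ∀ j ∈ A, i ≠ j → |cov[X i, X j; P]| ≤ ε) :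
    P.real (⋂ i ∈ A, {ω | z < |X i ω|}) ≤
      2 ^ A.card * exp (-(z ^ 2 / 2 * (A.card - A.card ^ 2 * ε))) := by
  refine (h.measure_biInter_abs_gt_le A z (u := fun _ => z) fun _ => hz).trans ?_
  gcongr
  have h1 : ∑ i ∈ A, ∑ j ∈ A, |cov[X i, X j; P]| ≤
      ∑ i ∈ A, ∑ j ∈ A, ((if i = j then 1 else 0) + ε) := by
    refine Finset.sum_le_sum fun i hi => Finset.sum_le_sum fun j hj => ?_
    split_ifs with hij
    · linarith [h.abs_cov_le_one i j]
    · linarith [hA i hi j hj hij]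
  have h2 : ∑ i ∈ A, ∑ j ∈ A, ((if i = j then (1 : ℝ) else 0) + ε) = A.card + A.card ^ 2 * ε := by
    simp [Finset.sum_add_distrib]
    ring
  simp_rw [← Finset.mul_sum]
  rw [Finset.sum_const, nsmul_eq_mul]
  have h3 := mul_le_mul_of_nonneg_left (h1.trans h2.le) (mul_self_nonneg z)
  nlinarith

lemma measure_biInter_insert_insert_le (h : IsStdGaussianFamily X P) {S : Finset V} {a b : V}
    (ha : a ∉ S) (hb : b ∉ S) (hab : a ≠ b) {z ε ρ : ℝ} (hz : 0 ≤ z) (hε : 0 ≤ ε) (hρ : 0 ≤ ρ)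
    (hcov : |cov[X a, X b; P]| ≤ ρ)
    (hS : ∀ i ∈ S, ∀ j ∈ insert b (insert a S), i ≠ j → |cov[X i, X j; P]| ≤ ε) :
    P.real (⋂ i ∈ insert b (insert a S), {ω | z < |X i ω|}) ≤ 2 ^ (S.card + 2) *
      exp (-(z ^ 2 / 2 * (S.card + 1 + (1 - ρ) / (1 + ρ) - (S.card + 2) ^ 2 * ε))) := by
  set θ : ℝ := 1 / (1 + ρ)
  have hθ : 0 ≤ θ := by positivity
  have hθ1 : θ ≤ 1 := (div_le_one (by positivity)).2 (by linarith)
  have hθρ : θ * (1 + ρ) = 1 := one_div_mul_cancel (by positivity)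
  have hg : (1 - ρ) / (1 + ρ) = 2 * θ - 1 := by simp only [θ]; field_simp; ring
  set T := insert b (insert a S)
  have hbT : b ∉ insert a S := by simp [hb, hab.symm]
  have hcard : T.card = S.card + 2 := by
    rw [Finset.card_insert_of_notMem hbT, Finset.card_insert_of_notMem ha]
  let w : V → ℝ := fun i => if i = a ∨ i = b then θ else 1
  have hw0 : ∀ i, 0 ≤ w i := fun i => by simp only [w]; split_ifs <;> positivity
  have hw1 : ∀ i, w i ≤ 1 := fun i => by simp only [w]; split_ifs <;> linarith
  have hwS : ∀ i ∈ S, w i = 1 := fun i hi => by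
    simp only [w]
    rw [if_neg]
    rintro (rfl | rfl)
    exacts [ha hi, hb hi]
  have hwa : w a = θ := by simp [w]
  have hwb : w b = θ := by simp [w]
  have hsum : ∑ i ∈ T, w i = S.card + 2 * θ := by
    rw [Finset.sum_insert hbT, Finset.sum_insert ha, Finset.sum_congr rfl hwS, hwa, hwb]
    simp
    ring
  have hterm : ∀ i ∈ T, ∀ j ∈ T, w i * w j * |cov[X i, X j; P]| ≤
      (if i = j then w i ^ 2 else 0) + ε +
        ((if i = a then if j = b then θ ^ 2 * ρ else 0 else 0) +
          (if i = b then if j = a then θ ^ 2 * ρ else 0 else 0)) := by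
    intro i hi j hj
    have hnn : ∀ p q : Prop, ∀ [Decidable p] [Decidable q],
        0 ≤ (if p then if q then θ ^ 2 * ρ else 0 else 0) := by
      intro p q _ _; split_ifs <;> positivity
    have hww : w i * w j ≤ 1 := mul_le_one₀ (hw1 i) (hw0 j) (hw1 j)
    have hww0 := mul_nonneg (hw0 i) (hw0 j)
    by_cases hij : i = j
    · subst hij
      rw [if_pos rfl]
      have := mul_le_of_le_one_right hww0 (h.abs_cov_le_one i i)
      linarith [hnn (i = a) (i = b), hnn (i = b) (i = a), pow_two (w i)]
    rw [if_neg hij]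
    by_cases hε' : |cov[X i, X j; P]| ≤ ε
    · have := (mul_le_of_le_one_left (abs_nonneg cov[X i, X j; P]) hww).trans hε'
      linarith [hnn (i = a) (j = b), hnn (i = b) (j = a)]
    have hiS : i ∉ S := fun hiS => hε' (hS i hiS j hj hij)
    have hjS : j ∉ S := fun hjS =>
      hε' (covariance_comm (X j) (X i) ▸ hS j hjS i hi (Ne.symm hij))
    simp only [T, Finset.mem_insert, hiS, hjS, or_false] at hi hj
    rcases hi with rfl | rfl <;> rcases hj with rfl | rfl
    · exact absurd rfl hij
    · rw [if_neg hij, if_pos rfl, if_pos rfl, hwa, hwb, covariance_comm]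
      nlinarith [mul_le_mul_of_nonneg_left hcov (sq_nonneg θ)]
    · rw [if_pos rfl, if_pos rfl, if_neg hij, hwa, hwb]
      nlinarith [mul_le_mul_of_nonneg_left hcov (sq_nonneg θ)]
    · exact absurd rfl hij
  have haT : a ∈ T := by simp [T]
  have hbT' : b ∈ T := by simp [T]
  have hsq : ∑ i ∈ T, w i ^ 2 = S.card + 2 * θ ^ 2 := by
    rw [Finset.sum_insert hbT, Finset.sum_insert ha, hwa, hwb,
      Finset.sum_congr rfl fun i hi => by rw [hwS i hi]]
    simp
    ring
  have hquad : ∑ i ∈ T, ∑ j ∈ T, w i * w j * |cov[X i, X j; P]| ≤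
      S.card + 2 * θ + (S.card + 2) ^ 2 * ε := by
    refine (Finset.sum_le_sum fun i hi => Finset.sum_le_sum fun j hj => hterm i hi j hj).trans
      (le_of_eq ?_)
    have h1 : ∑ i ∈ T, ∑ j ∈ T, (if i = j then w i ^ 2 else 0) = ∑ i ∈ T, w i ^ 2 :=
      Finset.sum_congr rfl fun i hi => by rw [Finset.sum_ite_eq, if_pos hi]
    have h2 : ∀ x y, x ∈ T → y ∈ T →
        ∑ i ∈ T, ∑ j ∈ T, (if i = x then if j = y then θ ^ 2 * ρ else 0 else 0) = θ ^ 2 * ρ := by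
      intro x y hx hy
      rw [Finset.sum_eq_single_of_mem x hx fun i _ hi => by simp [hi]]
      simp [hy]
    simp only [Finset.sum_add_distrib, h1, h2 a b haT hbT', h2 b a hbT' haT, hsq,
      Finset.sum_const, nsmul_eq_mul, hcard]
    push_cast
    linear_combination (2 * θ) * hθρ
  refine (h.measure_biInter_abs_gt_le T z (u := fun i => z * w i) fun i =>
    mul_nonneg hz (hw0 i)).trans ?_
  rw [hcard, ← Finset.mul_sum, hsum]
  gcongr
  have h5 : ∑ i ∈ T, ∑ j ∈ T, z * w i * (z * w j) * |cov[X i, X j; P]| =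
      z ^ 2 * ∑ i ∈ T, ∑ j ∈ T, w i * w j * |cov[X i, X j; P]| := by
    simp only [Finset.mul_sum]
    exact Finset.sum_congr rfl fun i _ => Finset.sum_congr rfl fun j _ => by ring
  rw [h5, hg]
  have := mul_le_mul_of_nonneg_left hquad (sq_nonneg z)
  nlinarith

/-- Subsets having a strongly correlated pair contribute little. -/
lemma sum_measure_biInter_strong_le (h : IsStdGaussianFamily X P) {z ε ρ D L : ℝ} (hz : 0 ≤ z)
    (hε : 0 ≤ ε) (hε1 : ε < 1) (hρ : 0 ≤ ρ) (hcov : ∀ i j, i ≠ j → |cov[X i, X j; P]| ≤ ρ)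
    (hD : 0 ≤ D) (hcard : ∀ i,
      ((Finset.univ.filter fun j => ε < |cov[X i, X j; P]|).card : ℝ) ≤ D)
    (hL : 1 ≤ L) (hVL : Fintype.card V * exp (-(z ^ 2 / 2)) ≤ L) (d : ℕ) :
    ∑ A ∈ (Finset.univ.powersetCard d).filter (fun A : Finset V =>
        ∃ i ∈ A, ∃ j ∈ A, i ≠ j ∧ ε < |cov[X i, X j; P]|),
      P.real (⋂ i ∈ A, {ω | z < |X i ω|}) ≤
    (d + 1) * (2 ^ d * (d * D ^ d) ^ d * L ^ d *
      exp (-(z ^ 2 / 2 * ((1 - ρ) / (1 + ρ) - d ^ 2 * ε)))) := by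
  classical
  set g := (1 - ρ) / (1 + ρ)
  let R : V → V → Prop := fun i j => ε < |cov[X i, X j; P]|
  have hrefl : ∀ i, R i i := fun i => by
    simp only [R]
    rw [covariance_self (h.meas i).aemeasurable, h.var]
    simpa using hε1
  have hsymm : ∀ i j, R i j → R j i := fun i j hij => by
    simp only [R] at hij ⊢
    rwa [covariance_comm]
  set F := (Finset.univ.powersetCard d).filter (fun A : Finset V =>
        ∃ i ∈ A, ∃ j ∈ A, i ≠ j ∧ ε < |cov[X i, X j; P]|)
  let B : ℕ → ℝ := fun k => 2 ^ d * exp (-(z ^ 2 / 2 * (k + g - d ^ 2 * ε)))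
  have hB : ∀ k, 0 ≤ B k := fun k => by positivity
  have hA : ∀ A ∈ F, P.real (⋂ i ∈ A, {ω | z < |X i ω|}) ≤
      ∑ k ∈ Finset.range (d + 1), ∑ S ∈ Finset.univ.powersetCard k,
        if A ⊆ (relNbhd R)^[d] S then B k else 0 := by
    intro A hAF
    obtain ⟨hAc, a, ha, b, hb, hab, hRab⟩ := Finset.mem_filter.1 hAF
    have hAd := (Finset.mem_powersetCard.1 hAc).2
    obtain ⟨S, hSA, haS, hbS, hSS, hSb, hball⟩ :=
      exists_cluster_representatives (R := R) hrefl hsymm ha hb hab hRab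
    have hinsA : insert b S ⊆ A := Finset.insert_subset hb hSA
    have hSd : S.card + 1 ≤ d := by
      rw [← Finset.card_insert_of_notMem hbS, ← hAd]
      exact Finset.card_le_card hinsA
    have hle : P.real (⋂ i ∈ A, {ω | z < |X i ω|}) ≤ B S.card := by
      have hSe : insert a (S.erase a) = S := Finset.insert_erase haS
      have hSc : (S.erase a).card + 1 = S.card := Finset.card_erase_add_one haS
      have key := h.measure_biInter_insert_insert_le (S := S.erase a) (a := a) (b := b) (by simp)
        (fun hb' => hbS (Finset.mem_of_mem_erase hb')) hab hz hε hρ (hcov a b hab) (by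
          intro i hi j hj hij
          rw [hSe, Finset.mem_insert] at hj
          obtain ⟨hia, hiS⟩ := Finset.mem_erase.1 hi
          rcases hj with rfl | hj
          · exact not_lt.1 (hSb i hiS hia)
          · exact not_lt.1 (hSS i hiS j hj hij))
      rw [hSe] at key
      refine (measureReal_mono (Set.biInter_subset_biInter_left hinsA)).trans (key.trans ?_)
      have hc : ((S.erase a).card : ℝ) + 1 = S.card := by exact_mod_cast hSc
      have hc2 : ((S.erase a).card : ℝ) + 2 ≤ d := by
        have : (S.card : ℝ) + 1 ≤ d := by exact_mod_cast hSd
        linarith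
      simp only [B]
      rw [hc]
      gcongr
      · norm_num
      · omega
    rw [hAd] at hball
    calc _ ≤ B S.card := hle
      _ = if A ⊆ (relNbhd R)^[d] S then B S.card else 0 := (if_pos hball).symm
      _ ≤ ∑ S' ∈ Finset.univ.powersetCard S.card,
          if A ⊆ (relNbhd R)^[d] S' then B S.card else 0 :=
        Finset.single_le_sum (f := fun S' => if A ⊆ (relNbhd R)^[d] S' then B S.card else 0)
          (fun S' _ => by split_ifs; exacts [hB _, le_rfl])
          (Finset.mem_powersetCard.2 ⟨Finset.subset_univ _, rfl⟩)
      _ ≤ _ := Finset.single_le_sum (f := fun k => ∑ S' ∈ Finset.univ.powersetCard k,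
          if A ⊆ (relNbhd R)^[d] S' then B k else 0)
          (fun k _ => Finset.sum_nonneg fun S' _ => by split_ifs; exacts [hB _, le_rfl])
          (Finset.mem_range.2 (by omega))
  have hfib : ∀ k ∈ Finset.range (d + 1), ∀ S ∈ Finset.univ.powersetCard k,
      ∑ A ∈ F, (if A ⊆ (relNbhd R)^[d] S then B k else 0) ≤ (d * D ^ d) ^ d * B k := by
    intro k hk S hS
    have hkd : (k : ℝ) ≤ d := by exact_mod_cast Nat.lt_succ_iff.1 (Finset.mem_range.1 hk)
    rw [← Finset.sum_filter, Finset.sum_const, nsmul_eq_mul]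
    refine mul_le_mul_of_nonneg_right ?_ (hB k)
    have hsub : F.filter (fun A => A ⊆ (relNbhd R)^[d] S) ⊆
        ((relNbhd R)^[d] S).powersetCard d := fun A hA => by
      obtain ⟨hAF, hAS⟩ := Finset.mem_filter.1 hA
      exact Finset.mem_powersetCard.2
        ⟨hAS, (Finset.mem_powersetCard.1 (Finset.mem_filter.1 hAF).1).2⟩
    have hb := card_iterate_relNbhd_le (R := R) hD hcard S d
    rw [(Finset.mem_powersetCard.1 hS).2] at hb
    calc ((F.filter fun A => A ⊆ (relNbhd R)^[d] S).card : ℝ)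
        ≤ (((relNbhd R)^[d] S).powersetCard d).card := by exact_mod_cast Finset.card_le_card hsub
      _ ≤ (((relNbhd R)^[d] S).card : ℝ) ^ d := by
          rw [Finset.card_powersetCard]; exact_mod_cast Nat.choose_le_pow _ _
      _ ≤ (d * D ^ d) ^ d := by gcongr; exact hb.trans (by gcongr)
  have hlevel : ∀ k ∈ Finset.range (d + 1),
      ∑ _S ∈ (Finset.univ : Finset V).powersetCard k, (d * D ^ d) ^ d * B k ≤
        2 ^ d * (d * D ^ d) ^ d * L ^ d * exp (-(z ^ 2 / 2 * (g - d ^ 2 * ε))) := by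
    intro k hk
    have hkd : k ≤ d := Nat.lt_succ_iff.1 (Finset.mem_range.1 hk)
    rw [Finset.sum_const, Finset.card_powersetCard, nsmul_eq_mul, Finset.card_univ]
    have h1 : ((Fintype.card V).choose k : ℝ) * exp (-(z ^ 2 / 2)) ^ k ≤ L ^ d := by
      calc _ ≤ (Fintype.card V : ℝ) ^ k * exp (-(z ^ 2 / 2)) ^ k := by
            gcongr; exact_mod_cast Nat.choose_le_pow _ _
        _ = (Fintype.card V * exp (-(z ^ 2 / 2))) ^ k := (mul_pow _ _ _).symm
        _ ≤ L ^ k := by gcongr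
        _ ≤ L ^ d := pow_le_pow_right₀ hL hkd
    have h2 : B k = 2 ^ d * (exp (-(z ^ 2 / 2)) ^ k * exp (-(z ^ 2 / 2 * (g - d ^ 2 * ε)))) := by
      simp only [B]
      rw [← exp_nat_mul, ← exp_add]
      ring_nf
    rw [h2]
    calc _ = 2 ^ d * (d * D ^ d) ^ d * (((Fintype.card V).choose k : ℝ) * exp (-(z ^ 2 / 2)) ^ k) *
          exp (-(z ^ 2 / 2 * (g - d ^ 2 * ε))) := by ring
      _ ≤ _ := by gcongr
  calc _ ≤ ∑ A ∈ F, ∑ k ∈ Finset.range (d + 1), ∑ S ∈ Finset.univ.powersetCard k,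
        (if A ⊆ (relNbhd R)^[d] S then B k else 0) := Finset.sum_le_sum hA
    _ = ∑ k ∈ Finset.range (d + 1), ∑ S ∈ Finset.univ.powersetCard k, ∑ A ∈ F,
        (if A ⊆ (relNbhd R)^[d] S then B k else 0) := by
        rw [Finset.sum_comm]
        exact Finset.sum_congr rfl fun k _ => Finset.sum_comm
    _ ≤ ∑ k ∈ Finset.range (d + 1), ∑ _S ∈ (Finset.univ : Finset V).powersetCard k,
        (d * D ^ d) ^ d * B k :=
        Finset.sum_le_sum fun k hk => Finset.sum_le_sum fun S hS => hfib k hk S hS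
    _ ≤ ∑ _k ∈ Finset.range (d + 1), 2 ^ d * (d * D ^ d) ^ d * L ^ d *
        exp (-(z ^ 2 / 2 * (g - d ^ 2 * ε))) := Finset.sum_le_sum hlevel
    _ = _ := by simp

/-- Subsets whose pairs are all weakly correlated, but not all very weakly, contribute little. -/
lemma sum_measure_biInter_moderate_le (h : IsStdGaussianFamily X P) {z ε τ e L : ℝ}
    (hz : 0 ≤ z) (hε : 0 ≤ ε) (he : 0 ≤ e)
    (hE : ((Finset.univ.filter fun p : V × V =>
      p.1 ≠ p.2 ∧ τ < |cov[X p.1, X p.2; P]|).card : ℝ) ≤ Fintype.card V ^ 2 * e)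
    (hVL : Fintype.card V * exp (-(z ^ 2 / 2)) ≤ L) (d : ℕ) :
    ∑ A ∈ (Finset.univ.powersetCard d).filter (fun A : Finset V =>
        (∀ i ∈ A, ∀ j ∈ A, i ≠ j → |cov[X i, X j; P]| ≤ ε) ∧
        ∃ i ∈ A, ∃ j ∈ A, i ≠ j ∧ τ < |cov[X i, X j; P]|),
      P.real (⋂ i ∈ A, {ω | z < |X i ω|}) ≤
    2 ^ d * L ^ d * e * exp (z ^ 2 / 2 * (d ^ 2 * ε)) := by
  set F := (Finset.univ.powersetCard d).filter (fun A : Finset V =>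
        (∀ i ∈ A, ∀ j ∈ A, i ≠ j → |cov[X i, X j; P]| ≤ ε) ∧
        ∃ i ∈ A, ∃ j ∈ A, i ≠ j ∧ τ < |cov[X i, X j; P]|)
  have hF : (F.card : ℝ) ≤ Fintype.card V ^ d * e := by
    refine le_trans (Nat.cast_le.2 (Finset.card_le_card fun A hA => ?_))
      (card_powersetCard_filter_lt_le (c := fun i j => |cov[X i, X j; P]|) he hE d)
    obtain ⟨hAc, -, hAτ⟩ := Finset.mem_filter.1 hA
    exact Finset.mem_filter.2 ⟨hAc, hAτ⟩
  have hq : ∀ A ∈ F, P.real (⋂ i ∈ A, {ω | z < |X i ω|}) ≤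
      2 ^ d * exp (-(z ^ 2 / 2 * (d - d ^ 2 * ε))) := fun A hA => by
    obtain ⟨hAc, hAε, -⟩ := Finset.mem_filter.1 hA
    have := h.measure_biInter_abs_gt_le_of_abs_cov_le hz hε hAε
    rwa [(Finset.mem_powersetCard.1 hAc).2] at this
  have hexp : exp (-(z ^ 2 / 2 * (d - d ^ 2 * ε))) =
      exp (-(z ^ 2 / 2)) ^ d * exp (z ^ 2 / 2 * (d ^ 2 * ε)) := by
    rw [← exp_nat_mul, ← exp_add]
    ring_nf
  calc _ ≤ F.card * (2 ^ d * exp (-(z ^ 2 / 2 * (d - d ^ 2 * ε)))) := by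
        rw [← nsmul_eq_mul]
        exact Finset.sum_le_card_nsmul _ _ _ hq
    _ ≤ (Fintype.card V ^ d * e) * (2 ^ d * exp (-(z ^ 2 / 2 * (d - d ^ 2 * ε)))) := by gcongr
    _ = 2 ^ d * (Fintype.card V * exp (-(z ^ 2 / 2))) ^ d * e *
        exp (z ^ 2 / 2 * (d ^ 2 * ε)) := by rw [hexp, mul_pow]; ring
    _ ≤ _ := by gcongr

end IsStdGaussianFamily
end BadSets

section Assembly

variable {Ω : Type*} [MeasurableSpace Ω] {P : Measure Ω} [IsProbabilityMeasure P]

lemma IsStdGaussianFamily.measure_biInter_abs_gt_bounds {V : Type*} [Fintype V] [DecidableEq V]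
    {X : V → Ω → ℝ} (h : IsStdGaussianFamily X P) {A : Finset V} {d : ℕ} (hd : A.card = d) {τ : ℝ}
    (hτ : 0 ≤ τ) (hτ1 : d * τ < 1)
    (hA : ∀ i ∈ A, ∀ j ∈ A, i ≠ j → |cov[X i, X j; P]| ≤ τ) (z : ℝ) :
    P.real (⋂ i ∈ A, {ω | z < |X i ω|}) ≤
        (√(1 + d * τ) / √(1 - d * τ)) ^ d * gaussianTail (z / √(1 + d * τ)) ^ d ∧
      (√(1 - d * τ) / √(1 + d * τ)) ^ d * gaussianTail (z / √(1 - d * τ)) ^ d ≤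
        P.real (⋂ i ∈ A, {ω | z < |X i ω|}) := by
  have hI : (⋂ i ∈ A, {ω | z < |X i ω|}) = ⋂ i : A, {ω | z < |X i ω|} := by ext; simp
  rw [hI]
  have := (h.subfamily A).measure_forall_abs_gt_bounds hτ (by rwa [Fintype.card_coe, hd])
    (fun i j hij => hA i i.2 j j.2 fun hc => hij (Subtype.ext hc)) z
  rwa [Fintype.card_coe, hd] at this

lemma tendsto_choose_div_pow {s : ℕ → ℕ} (hs : Tendsto s atTop atTop) (d : ℕ) :
    Tendsto (fun n => ((s n).choose d : ℝ) / (s n : ℝ) ^ d) atTop (nhds (1 / d.factorial)) := by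
  have hne : ∀ᶠ n : ℕ in atTop, (n : ℝ) ^ d / d.factorial ≠ 0 := by
    filter_upwards [eventually_ne_atTop 0] with n hn
    positivity
  have h := (((isEquivalent_iff_tendsto_one hne).1 (isEquivalent_choose d)).comp hs).div_const
    (d.factorial : ℝ)
  refine h.congr fun n => ?_
  have : (d.factorial : ℝ) ≠ 0 := by positivity
  simp only [Function.comp_apply, Pi.div_apply]
  field_simp

variable {s : ℕ → ℕ} {X : ∀ n, Fin (s n) → Ω → ℝ} {z : ℝ} {ζ : ℕ → ℝ}

lemma eventually_sq_div_two_bounds (hs : Tendsto s atTop atTop)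
    (hζ : Tendsto (fun n => ζ n ^ 2 -
      (2 * log (s n) - log (log (s n)) - log π + 2 * z)) atTop (nhds 0)) {η : ℝ} (hη : 0 < η) :
    ∀ᶠ n in atTop, (1 - η) * log (s n) ≤ ζ n ^ 2 / 2 ∧ ζ n ^ 2 / 2 ≤ (1 + η) * log (s n) := by
  have hl : Tendsto (fun n => log (s n)) atTop atTop :=
    tendsto_log_atTop.comp (tendsto_natCast_atTop_atTop.comp hs)
  have h := tendsto_sq_div_log hs hζ
  filter_upwards [h.eventually_const_le (show 2 * (1 - η) < 2 by linarith),
    h.eventually_le_const (show 2 < 2 * (1 + η) by linarith), hl.eventually_gt_atTop 0]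
    with n h1 h2 h3
  rw [le_div_iff₀ h3] at h1
  rw [div_le_iff₀ h3] at h2
  constructor <;> linarith

lemma tendsto_const_mul_rpow_neg (hs : Tendsto s atTop atTop) (C : ℝ) {c : ℝ} (hc : 0 < c) :
    Tendsto (fun n => C * (s n : ℝ) ^ (-c)) atTop (nhds 0) := by
  simpa using ((tendsto_rpow_neg_atTop hc).comp
    (tendsto_natCast_atTop_atTop.comp hs)).const_mul C

lemma tendsto_sum_strong (h : ∀ n, IsStdGaussianFamily (X n) P) (hs : Tendsto s atTop atTop)
    (hB : CondB1 s (fun n i j => cov[X n i, X n j; P]) ∨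
      CondB2 s (fun n i j => cov[X n i, X n j; P]))
    (hpos : ∀ n, 0 < ζ n)
    (hζ : Tendsto (fun n => ζ n ^ 2 -
      (2 * log (s n) - log (log (s n)) - log π + 2 * z)) atTop (nhds 0))
    {ε ρ : ℝ} (hε : 0 < ε) (hε1 : ε < 1) (hρ : 0 ≤ ρ) (hρ1 : ρ < 1)
    (hcov : ∀ᶠ n in atTop, ∀ i j, i ≠ j → |cov[X n i, X n j; P]| ≤ ρ) (d : ℕ)
    (hεd : d ^ 2 * ε ≤ (1 - ρ) / (1 + ρ) / 2) :
    Tendsto (fun n => ∑ A ∈ (Finset.univ.powersetCard d).filter (fun A : Finset (Fin (s n)) =>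
        ∃ i ∈ A, ∃ j ∈ A, i ≠ j ∧ ε < |cov[X n i, X n j; P]|),
      P.real (⋂ i ∈ A, {ω | ζ n < |X n i ω|})) atTop (nhds 0) := by
  set g := (1 - ρ) / (1 + ρ)
  have hg : 0 < g := div_pos (by linarith) (by linarith)
  set η : ℝ := min (1 / 2) (g / 8 / (d ^ 2 + d + 1))
  have hη : 0 < η := lt_min (by norm_num) (by positivity)
  have hη1 : η ≤ 1 / 2 := min_le_left _ _
  have hη2 : η * (d ^ 2 + d + 1) ≤ g / 8 :=
    (le_div_iff₀ (by positivity)).1 (min_le_right _ _)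
  refine tendsto_of_tendsto_of_tendsto_of_le_of_le' tendsto_const_nhds
    (tendsto_const_mul_rpow_neg hs ((d + 1) * (2 ^ d * d ^ d)) (show 0 < g / 8 by positivity))
    (Eventually.of_forall fun n => Finset.sum_nonneg fun A _ => measureReal_nonneg) ?_
  filter_upwards [eventually_sq_div_two_bounds hs hζ hη, hs.eventually_gt_atTop 1, hcov,
    eventually_card_filter_le hs (fun n i j => (h n).abs_cov_le_one i j) hB hε hη]
    with n hzn hsn hρn hDn
  have hN : (1 : ℝ) < s n := by exact_mod_cast hsn
  have hN0 : (0 : ℝ) < s n := one_pos.trans hN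
  have hl : 0 < log (s n) := log_pos hN
  have hpow : ∀ t : ℝ, (s n : ℝ) ^ t = exp (log (s n) * t) := fun t => rpow_def_of_pos hN0 t
  have hVL : Fintype.card (Fin (s n)) * exp (-(ζ n ^ 2 / 2)) ≤ (s n : ℝ) ^ η := by
    rw [Fintype.card_fin, hpow]
    nth_rw 1 [← exp_log hN0]
    rw [← exp_add]
    exact exp_le_exp.2 (by linarith [hzn.1])
  have key := (h n).sum_measure_biInter_strong_le (hpos n).le hε.le hε1 hρ hρn (by positivity) hDn
    (one_le_rpow hN.le hη.le) hVL d
  refine (Eq.trans_le ?_ key).trans ?_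
  · congr!
  have hexp : ((s n : ℝ) ^ η) ^ (d * d) * ((s n : ℝ) ^ η) ^ d *
      exp (-(ζ n ^ 2 / 2 * (g - d ^ 2 * ε))) ≤ (s n : ℝ) ^ (-(g / 8)) := by
    rw [hpow, hpow, ← exp_nat_mul, ← exp_nat_mul, ← exp_add, ← exp_add]
    refine exp_le_exp.2 ?_
    push_cast
    have h1 : log (s n) * (1 / 2) * (g / 2) ≤ ζ n ^ 2 / 2 * (g - d ^ 2 * ε) := by
      refine mul_le_mul ?_ (by linarith) (by positivity) (by positivity)
      nlinarith [hzn.1]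
    nlinarith [mul_le_mul_of_nonneg_left hη2 hl.le, mul_pos hl hη]
  calc _ = (d + 1) * (2 ^ d * d ^ d) * (((s n : ℝ) ^ η) ^ (d * d) * ((s n : ℝ) ^ η) ^ d *
      exp (-(ζ n ^ 2 / 2 * (g - d ^ 2 * ε)))) := by rw [mul_pow, pow_mul]; ring
    _ ≤ _ := by gcongr

lemma tendsto_sum_moderate (h : ∀ n, IsStdGaussianFamily (X n) P) (hs : Tendsto s atTop atTop)
    (hpos : ∀ n, 0 < ζ n)
    (hζ : Tendsto (fun n => ζ n ^ 2 -
      (2 * log (s n) - log (log (s n)) - log π + 2 * z)) atTop (nhds 0))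
    {ε κ : ℝ} (hε : 0 < ε) (hκ : 0 < κ) {τ : ℕ → ℝ}
    (hE : ∀ᶠ n in atTop, ((Finset.univ.filter fun p : Fin (s n) × Fin (s n) =>
      p.1 ≠ p.2 ∧ τ n < |cov[X n p.1, X n p.2; P]|).card : ℝ) ≤ (s n : ℝ) ^ 2 * (s n : ℝ) ^ (-κ))
    (d : ℕ) (hεd : d ^ 2 * ε ≤ κ / 8) :
    Tendsto (fun n => ∑ A ∈ (Finset.univ.powersetCard d).filter (fun A : Finset (Fin (s n)) =>
        (∀ i ∈ A, ∀ j ∈ A, i ≠ j → |cov[X n i, X n j; P]| ≤ ε) ∧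
        ∃ i ∈ A, ∃ j ∈ A, i ≠ j ∧ τ n < |cov[X n i, X n j; P]|),
      P.real (⋂ i ∈ A, {ω | ζ n < |X n i ω|})) atTop (nhds 0) := by
  set η : ℝ := min 1 (κ / 4 / (d + 1))
  have hη : 0 < η := lt_min one_pos (by positivity)
  have hη1 : η ≤ 1 := min_le_left _ _
  have hη2 : η * (d + 1) ≤ κ / 4 := (le_div_iff₀ (by positivity)).1 (min_le_right _ _)
  refine tendsto_of_tendsto_of_tendsto_of_le_of_le' tendsto_const_nhds
    (tendsto_const_mul_rpow_neg hs (2 ^ d) (show 0 < κ / 2 by positivity))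
    (Eventually.of_forall fun n => Finset.sum_nonneg fun A _ => measureReal_nonneg) ?_
  filter_upwards [eventually_sq_div_two_bounds hs hζ hη, hs.eventually_gt_atTop 1, hE]
    with n hzn hsn hEn
  have hN : (1 : ℝ) < s n := by exact_mod_cast hsn
  have hN0 : (0 : ℝ) < s n := one_pos.trans hN
  have hl : 0 < log (s n) := log_pos hN
  have hpow : ∀ t : ℝ, (s n : ℝ) ^ t = exp (log (s n) * t) := fun t => rpow_def_of_pos hN0 t
  have hVL : Fintype.card (Fin (s n)) * exp (-(ζ n ^ 2 / 2)) ≤ (s n : ℝ) ^ η := by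
    rw [Fintype.card_fin, hpow]
    nth_rw 1 [← exp_log hN0]
    rw [← exp_add]
    exact exp_le_exp.2 (by linarith [hzn.1])
  have key := (h n).sum_measure_biInter_moderate_le (hpos n).le hε.le (e := (s n : ℝ) ^ (-κ))
    (by positivity) (by rwa [Fintype.card_fin]) hVL d
  refine (Eq.trans_le ?_ key).trans ?_
  · congr!
  rw [mul_assoc, mul_assoc]
  refine mul_le_mul_of_nonneg_left ?_ (by positivity)
  rw [hpow, hpow, hpow, ← exp_nat_mul, ← exp_add, ← exp_add]
  refine exp_le_exp.2 ?_
  have h1 : ζ n ^ 2 / 2 * (d ^ 2 * ε) ≤ (2 * log (s n)) * (κ / 8) := by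
    refine mul_le_mul ?_ hεd (by positivity) (by positivity)
    nlinarith [hzn.2]
  nlinarith [mul_le_mul_of_nonneg_left hη2 hl.le, mul_pos hl hη]

lemma tendsto_mul_gaussianTail_pow (hs : Tendsto s atTop atTop) (hpos : ∀ n, 0 < ζ n)
    (hζ : Tendsto (fun n => ζ n ^ 2 -
      (2 * log (s n) - log (log (s n)) - log π + 2 * z)) atTop (nhds 0)) {m : ℕ → ℝ} {d : ℕ} {L : ℝ}
    (hm : Tendsto (fun n => m n / (s n : ℝ) ^ d) atTop (nhds L)) (δ : ℝ) :
    Tendsto (fun n => m n * ((√(1 + d * (δ / log (s n))) / √(1 - d * (δ / log (s n)))) ^ d *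
      gaussianTail (ζ n / √(1 + d * (δ / log (s n)))) ^ d)) atTop
      (nhds (L * exp (-(d * (z - d * δ))))) := by
  have hl : Tendsto (fun n => log (s n)) atTop atTop :=
    tendsto_log_atTop.comp (tendsto_natCast_atTop_atTop.comp hs)
  have hτ : Tendsto (fun n => d * (δ / log (s n))) atTop (nhds 0) := by
    simpa using ((tendsto_const_nhds (x := δ)).div_atTop hl).const_mul (d : ℝ)
  have hp : Tendsto (fun n => √(1 + d * (δ / log (s n)))) atTop (nhds 1) := by
    simpa using (hτ.const_add 1).sqrt
  have hq : Tendsto (fun n => √(1 - d * (δ / log (s n)))) atTop (nhds 1) := by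
    simpa using (hτ.const_sub 1).sqrt
  have hT := tendsto_mul_gaussianTail_div_sqrt hs hpos hζ (d * δ)
  have := hm.mul (((hp.div hq one_ne_zero).pow d).mul (hT.pow d))
  rw [div_one, one_pow, one_mul, ← exp_nat_mul, mul_neg] at this
  refine this.congr' ?_
  filter_upwards [hs.eventually_gt_atTop 0] with n hn
  have hN : (s n : ℝ) ≠ 0 := by exact_mod_cast hn.ne'
  rw [Pi.div_apply, mul_div_assoc (d : ℝ) δ, mul_pow]
  field_simp

lemma eventually_card_pairs_le {r : ∀ n, Fin (s n) → Fin (s n) → ℝ}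
    (hB : CondB1 s r ∨ CondB2 s r) (hs : Tendsto s atTop atTop) (hr : ∀ n i j, |r n i j| ≤ 1) :
    ∃ κ : ℝ, 0 < κ ∧ ∀ δ : ℝ, 0 < δ →
    ∀ᶠ n in atTop, ((Finset.univ.filter fun p : Fin (s n) × Fin (s n) =>
      p.1 ≠ p.2 ∧ δ / log (s n) < |r n p.1 p.2|).card : ℝ) ≤
        (s n : ℝ) ^ 2 * (s n : ℝ) ^ (-κ) := by
  obtain ⟨κ, hκ, h⟩ : ∃ κ : ℝ, 0 < κ ∧ ∀ δ : ℝ, 0 < δ →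
      ∀ᶠ n in atTop, ((Finset.univ.filter fun p : Fin (s n) × Fin (s n) =>
        p.1 ≠ p.2 ∧ δ / log (s n) < |r n p.1 p.2|).card : ℝ) ≤ (s n : ℝ) ^ (2 - κ) :=
    hB.elim (fun h => ⟨1 / 2, one_half_pos, fun δ hδ => h.eventually_card_pairs_le hs hr hδ⟩)
      fun h => h.eventually_card_pairs_le hs
  refine ⟨κ, hκ, fun δ hδ => ?_⟩
  filter_upwards [h δ hδ, hs.eventually_gt_atTop 0] with n hn hs0
  refine hn.trans (le_of_eq ?_)
  rw [sub_eq_add_neg, rpow_add (by exact_mod_cast hs0)]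
  norm_cast

/-- The `d`-th factorial moment sums are sandwiched, up to a vanishing error, between two sequences
that only involve the Gaussian tail. -/
lemma eventually_sum_measure_biInter_bounds (h : ∀ n, IsStdGaussianFamily (X n) P)
    (hs : Tendsto s atTop atTop) {d : ℕ} {δ ε κ : ℝ} (hδ : 0 < δ)
    (hE : ∀ᶠ n in atTop, ((Finset.univ.filter fun p : Fin (s n) × Fin (s n) =>
      p.1 ≠ p.2 ∧ δ / log (s n) < |cov[X n p.1, X n p.2; P]|).card : ℝ) ≤
        (s n : ℝ) ^ 2 * (s n : ℝ) ^ (-κ)) :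
    ∀ᶠ n in atTop,
      ((s n).choose d - (s n : ℝ) ^ d * (s n : ℝ) ^ (-κ)) *
          ((√(1 + d * (-δ / log (s n))) / √(1 - d * (-δ / log (s n)))) ^ d *
            gaussianTail (ζ n / √(1 + d * (-δ / log (s n)))) ^ d) ≤
        ∑ A ∈ (Finset.univ : Finset (Fin (s n))).powersetCard d,
          P.real (⋂ i ∈ A, {ω | ζ n < |X n i ω|}) ∧
      ∑ A ∈ (Finset.univ : Finset (Fin (s n))).powersetCard d,
          P.real (⋂ i ∈ A, {ω | ζ n < |X n i ω|}) ≤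
        (s n).choose d * ((√(1 + d * (δ / log (s n))) / √(1 - d * (δ / log (s n)))) ^ d *
            gaussianTail (ζ n / √(1 + d * (δ / log (s n)))) ^ d) +
          (∑ A ∈ (Finset.univ.powersetCard d).filter (fun A : Finset (Fin (s n)) =>
            ∃ i ∈ A, ∃ j ∈ A, i ≠ j ∧ ε < |cov[X n i, X n j; P]|),
            P.real (⋂ i ∈ A, {ω | ζ n < |X n i ω|}) +
          ∑ A ∈ (Finset.univ.powersetCard d).filter (fun A : Finset (Fin (s n)) =>
            (∀ i ∈ A, ∀ j ∈ A, i ≠ j → |cov[X n i, X n j; P]| ≤ ε) ∧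
            ∃ i ∈ A, ∃ j ∈ A, i ≠ j ∧ δ / log (s n) < |cov[X n i, X n j; P]|),
            P.real (⋂ i ∈ A, {ω | ζ n < |X n i ω|})) := by
  have hl : Tendsto (fun n => log (s n)) atTop atTop :=
    tendsto_log_atTop.comp (tendsto_natCast_atTop_atTop.comp hs)
  have hτ : Tendsto (fun n => d * (δ / log (s n))) atTop (nhds 0) := by
    simpa using ((tendsto_const_nhds (x := δ)).div_atTop hl).const_mul (d : ℝ)
  filter_upwards [hE, hl.eventually_gt_atTop 0, hτ.eventually_lt_const one_pos]
    with n hEn hln hτ1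
  have hτ0 : 0 ≤ δ / log (s n) := by positivity
  simp only [neg_div, mul_neg, sub_neg_eq_add, ← sub_eq_add_neg]
  set τ := δ / log (s n)
  set q : Finset (Fin (s n)) → ℝ := fun A => P.real (⋂ i ∈ A, {ω | ζ n < |X n i ω|})
  have hq0 : ∀ A, 0 ≤ q A := fun A => measureReal_nonneg
  set F := (Finset.univ : Finset (Fin (s n))).powersetCard d
  have hFcard : F.card = (s n).choose d := by simp [F]
  let bad : Finset (Fin (s n)) → Prop := fun A =>
    ∃ i ∈ A, ∃ j ∈ A, i ≠ j ∧ τ < |cov[X n i, X n j; P]|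
  have hbad : ((F.filter bad).card : ℝ) ≤ (s n : ℝ) ^ d * (s n : ℝ) ^ (-κ) := by
    have := card_powersetCard_filter_lt_le (V := Fin (s n)) (τ := τ) (e := (s n : ℝ) ^ (-κ))
      (c := fun i j => |cov[X n i, X n j; P]|) (by positivity) (by rwa [Fintype.card_fin]) d
    rw [Fintype.card_fin] at this
    convert this
  have hgood : ∀ A ∈ F.filter fun A => ¬ bad A, _ := fun A hA =>
    (h n).measure_biInter_abs_gt_bounds (Finset.mem_powersetCard.1 (Finset.mem_filter.1 hA).1).2
      hτ0 hτ1 (fun i hi j hj hij => not_lt.1 fun hlt =>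
        (Finset.mem_filter.1 hA).2 ⟨i, hi, j, hj, hij, hlt⟩) (ζ n)
  have hsplit := Finset.sum_filter_add_sum_filter_not F bad q
  have hcsplit := Finset.card_filter_add_card_filter_not (s := F) bad
  have hT : ∀ x, 0 ≤ gaussianTail x := fun x => measureReal_nonneg
  have hcsplit' : ((F.filter bad).card : ℝ) + (F.filter fun A => ¬ bad A).card =
      (s n).choose d := by
    rw [← hFcard, ← hcsplit]; push_cast; ring
  constructor
  · have h1 := Finset.card_nsmul_le_sum (F.filter fun A => ¬ bad A) q _ fun A hA => (hgood A hA).2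
    rw [nsmul_eq_mul] at h1
    refine le_trans (mul_le_mul_of_nonneg_right (by linarith) ?_) (h1.trans ?_)
    · exact mul_nonneg (by positivity) (pow_nonneg (hT _) _)
    · linarith [Finset.sum_nonneg fun A (_ : A ∈ F.filter bad) => hq0 A]
  · have h1 := Finset.sum_le_card_nsmul (F.filter fun A => ¬ bad A) q _ fun A hA => (hgood A hA).1
    rw [nsmul_eq_mul] at h1
    have h2 : ((F.filter fun A => ¬ bad A).card : ℝ) ≤ (s n).choose d := by
      linarith [Nat.cast_nonneg (α := ℝ) (F.filter bad).card]
    have h3 := h1.trans (mul_le_mul_of_nonneg_right h2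
      (mul_nonneg (by positivity) (pow_nonneg (hT _) _)))
    rw [← hsplit, add_comm]
    refine add_le_add h3 ?_
    rw [← Finset.sum_filter_add_sum_filter_not (F.filter bad)
      (fun A => ∃ i ∈ A, ∃ j ∈ A, i ≠ j ∧ ε < |cov[X n i, X n j; P]|)]
    refine add_le_add (Finset.sum_le_sum_of_subset_of_nonneg ?_ fun A _ _ => hq0 A)
      (Finset.sum_le_sum_of_subset_of_nonneg ?_ fun A _ _ => hq0 A)
    · intro A hA
      obtain ⟨hA, hAε⟩ := Finset.mem_filter.1 hA
      exact Finset.mem_filter.2 ⟨(Finset.mem_filter.1 hA).1, hAε⟩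
    · intro A hA
      obtain ⟨hA, hAε⟩ := Finset.mem_filter.1 hA
      exact Finset.mem_filter.2 ⟨(Finset.mem_filter.1 hA).1, fun i hi j hj hij =>
        not_lt.1 fun hlt => hAε ⟨i, hi, j, hj, hij, hlt⟩, (Finset.mem_filter.1 hA).2⟩

lemma tendsto_sum_measure_biInter (h : ∀ n, IsStdGaussianFamily (X n) P)
    (hs : Tendsto s atTop atTop)
    (hB : CondB1 s (fun n i j => cov[X n i, X n j; P]) ∨
      CondB2 s (fun n i j => cov[X n i, X n j; P]))
    (hpos : ∀ n, 0 < ζ n)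
    (hζ : Tendsto (fun n => ζ n ^ 2 -
      (2 * log (s n) - log (log (s n)) - log π + 2 * z)) atTop (nhds 0)) {d : ℕ} (hd : 1 ≤ d) :
    Tendsto (fun n => ∑ A ∈ (Finset.univ : Finset (Fin (s n))).powersetCard d,
      P.real (⋂ i ∈ A, {ω | ζ n < |X n i ω|})) atTop (nhds (exp (-(d * z)) / d.factorial)) := by
  have hr : ∀ n i j, |cov[X n i, X n j; P]| ≤ 1 := fun n i j => (h n).abs_cov_le_one i j
  obtain ⟨ρ, hρ, hρ1, hcov⟩ := eventually_abs_le_of_limsup_gammamax_lt hr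
    (hB.elim (fun h => h.2) fun h => h.2.2)
  obtain ⟨κ, hκ, hE⟩ := eventually_card_pairs_le hB hs hr
  have hd' : (1 : ℝ) ≤ d := by exact_mod_cast hd
  have hg : 0 < (1 - ρ) / (1 + ρ) := div_pos (by linarith) (by linarith)
  have hg1 : (1 - ρ) / (1 + ρ) ≤ 1 := (div_le_one (by linarith)).2 (by linarith)
  obtain ⟨ε, hε, hεg, hεκ⟩ : ∃ ε : ℝ, 0 < ε ∧ d ^ 2 * ε ≤ (1 - ρ) / (1 + ρ) / 2 ∧
      d ^ 2 * ε ≤ κ / 8 := by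
    refine ⟨min ((1 - ρ) / (1 + ρ) / 2) (κ / 8) / d ^ 2, by positivity, ?_⟩
    rw [mul_div_cancel₀ _ (by positivity)]
    exact ⟨min_le_left _ _, min_le_right _ _⟩
  have hε1 : ε < 1 := by nlinarith [one_le_pow₀ hd' (n := 2)]
  have hH := tendsto_sum_strong h hs hB hpos hζ hε hε1 hρ hρ1 hcov d hεg
  have hup : ∀ δ, 0 < δ → ∀ x, 1 / d.factorial * exp (-(d * (z - d * δ))) < x →
      ∀ᶠ n in atTop, ∑ A ∈ (Finset.univ : Finset (Fin (s n))).powersetCard d,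
        P.real (⋂ i ∈ A, {ω | ζ n < |X n i ω|}) < x := by
    intro δ hδ x hx
    have hM := tendsto_sum_moderate h hs hpos hζ hε hκ (hE δ hδ) d hεκ
    have hU := (tendsto_mul_gaussianTail_pow hs hpos hζ (tendsto_choose_div_pow hs d) δ).add
      (hH.add hM)
    rw [add_zero, add_zero] at hU
    filter_upwards [eventually_sum_measure_biInter_bounds (ζ := ζ) (ε := ε) h hs hδ (hE δ hδ),
      hU.eventually_lt_const hx] with n hn hnx
    exact hn.2.trans_lt hnx
  have hlow : ∀ δ, 0 < δ → ∀ x, x < 1 / d.factorial * exp (-(d * (z - d * -δ))) →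
      ∀ᶠ n in atTop, x < ∑ A ∈ (Finset.univ : Finset (Fin (s n))).powersetCard d,
        P.real (⋂ i ∈ A, {ω | ζ n < |X n i ω|}) := by
    intro δ hδ x hx
    have hm : Tendsto (fun n => ((s n).choose d - (s n : ℝ) ^ d * (s n : ℝ) ^ (-κ)) /
        (s n : ℝ) ^ d) atTop (nhds (1 / d.factorial)) := by
      have := (tendsto_choose_div_pow hs d).sub (tendsto_const_mul_rpow_neg hs 1 hκ)
      rw [sub_zero] at this
      refine this.congr' ?_
      filter_upwards [hs.eventually_gt_atTop 0] with n hn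
      have hN : (s n : ℝ) ≠ 0 := by exact_mod_cast hn.ne'
      field_simp
    filter_upwards [eventually_sum_measure_biInter_bounds (ζ := ζ) (ε := ε) h hs hδ (hE δ hδ),
      (tendsto_mul_gaussianTail_pow hs hpos hζ hm (-δ)).eventually_const_lt hx] with n hn hnx
    exact hnx.trans_le hn.1
  have hcont : ∀ c : ℝ, Tendsto (fun δ => 1 / d.factorial * exp (-(d * (z - d * (c * δ)))))
      (nhdsWithin 0 (Set.Ioi 0)) (nhds (exp (-(d * z)) / d.factorial)) := fun c => by
    have : Continuous fun δ => 1 / d.factorial * exp (-(d * (z - d * (c * δ)))) := by fun_prop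
    refine (this.tendsto' 0 _ ?_).mono_left nhdsWithin_le_nhds
    simp
    ring
  refine tendsto_order.2 ⟨fun x hx => ?_, fun x hx => ?_⟩
  · obtain ⟨δ, hδx, hδ⟩ := (((hcont (-1)).eventually_const_lt hx).and
      self_mem_nhdsWithin).exists
    exact hlow δ hδ x (by simpa using hδx)
  · obtain ⟨δ, hδx, hδ⟩ := (((hcont 1).eventually_lt_const hx).and
      self_mem_nhdsWithin).exists
    exact hup δ hδ x (by simpa using hδx)

end Assembly

/-- **Normal comparison principle.**
For each `n` let `(X_{n,i})_{i ∈ 𝓘ₙ}` be a centered Gaussian vector with unit variances,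
covariance matrix `Σ_n = (r_{n,i,j})`, `|𝓘ₙ| = s_n → ∞`, satisfying (B1) or (B2).  If
`z_n > 0` satisfies `z_n² = 2 log s_n − log log s_n − log π + 2z + o(1)`, then
`Q'_{n,d} = ∑_{𝓐 ⊆ 𝓘ₙ, |𝓐| = d} P(⋂_{i ∈ 𝓐} {|X_{n,i}| > z_n}) → e^{-dz}/d!` for all `d ≥ 1`. -/
theorem normal_comparison_principle
    {Ω : Type*} [MeasurableSpace Ω] (P : Measure Ω) [IsProbabilityMeasure P]
    (s : ℕ → ℕ) (hs : Tendsto s atTop atTop)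
    (X : ∀ n, Fin (s n) → Ω → ℝ)
    (hmeas : ∀ n i, Measurable (X n i))
    -- `(X_{n,i})_i` is a Gaussian random vector: every linear combination is Gaussian
    (hgauss : ∀ n (c : Fin (s n) → ℝ), ∃ (μ : ℝ) (v : NNReal),
      Measure.map (fun ω => ∑ i : Fin (s n), c i * X n i ω) P = gaussianReal μ v)
    (hmean : ∀ n i, ∫ ω, X n i ω ∂P = 0)
    (hvar : ∀ n i, variance (X n i) P = 1)
    (r : ∀ n, Fin (s n) → Fin (s n) → ℝ)
    (hr : ∀ n i j, r n i j = covRV P (X n i) (X n j))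
    (hB : CondB1 s r ∨ CondB2 s r)
    (z : ℝ) (zseq : ℕ → ℝ) (hzpos : ∀ n, 0 < zseq n)
    (hz : Tendsto
      (fun n => (zseq n) ^ 2 -
        (2 * Real.log (s n) - Real.log (Real.log (s n)) - Real.log π + 2 * z))
      atTop (nhds 0)) :
    ∀ d : ℕ, 1 ≤ d →
      Tendsto
        (fun n => ∑ 𝓐 ∈ Finset.powersetCard d (Finset.univ : Finset (Fin (s n))),
          (P (⋂ i ∈ 𝓐, {ω | zseq n < |X n i ω|})).toReal)
        atTop (nhds (Real.exp (-(d * z)) / (d.factorial : ℝ))) := by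
  intro d hd
  obtain rfl : r = fun n i j => cov[X n i, X n j; P] := by
    funext n i j
    exact hr n i j
  exact tendsto_sum_measure_biInter (fun n => ⟨hmeas n, hgauss n, hmean n, hvar n⟩) hs hB
    hzpos hz hd
end

section
/- For each n let Σ_n = (r_{n,i,j})_{i,j∈𝓘_n} be a symmetric matrix with |r_{n,i,j}| ≤ 1, and define G_n(t) = max_{i∈𝓘_n} Σ_{j∈𝓘_n} 1{|r_{n,i,j}| > t} and γ(n,b) = sup_{i∈𝓘_n} sup_{𝓐⊂𝓘_n, |𝓐|=b} inf_{j∈𝓐} |r_{n,i,j}|. Then γ(n,b_n) = o(1) for every sequence b_n → ∞ if and only if the sequence (G_n(t))_{n≥1} is bounded for every t > 0. -/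
open Filter

/-- `G_n(t) = max_{i ∈ 𝓘ₙ} #{j ∈ 𝓘ₙ : |r_{n,i,j}| > t}`. -/
noncomputable def Gfun (s : ℕ → ℕ) (r : ∀ n, Fin (s n) → Fin (s n) → ℝ)
    (n : ℕ) (t : ℝ) : ℕ :=
  Finset.univ.sup fun i : Fin (s n) =>
    (Finset.univ.filter fun j : Fin (s n) => t < |r n i j|).card

/-- The smallest absolute entry along a nonempty set of columns is at most each of them. -/
theorem sInf_abs_image_le {m : ℕ} (f : Fin m → ℝ) (A : Finset (Fin m)) {j : Fin m}
    (hj : j ∈ A) : sInf ((fun j => |f j|) '' (A : Set (Fin m))) ≤ |f j| :=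
  csInf_le ⟨0, by rintro _ ⟨k, -, rfl⟩; exact abs_nonneg _⟩ ⟨j, hj, rfl⟩

theorem gammafun_nonneg (s : ℕ → ℕ) (r : ∀ n, Fin (s n) → Fin (s n) → ℝ) (n b : ℕ) :
    0 ≤ gammafun s r n b := by
  apply Real.sSup_nonneg
  rintro _ ⟨i, A, -, rfl⟩
  apply Real.sInf_nonneg
  rintro _ ⟨j, -, rfl⟩
  exact abs_nonneg _

theorem gammafun_le_of_Gfun_lt (s : ℕ → ℕ) (r : ∀ n, Fin (s n) → Fin (s n) → ℝ)
    {n b : ℕ} {t : ℝ} (ht : 0 ≤ t) (h : Gfun s r n t < b) : gammafun s r n b ≤ t := by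
  apply Real.sSup_le _ ht
  rintro _ ⟨i, A, hA, rfl⟩
  have hrow : (Finset.univ.filter fun j : Fin (s n) => t < |r n i j|).card ≤ Gfun s r n t :=
    Finset.le_sup (f := fun i : Fin (s n) =>
      (Finset.univ.filter fun j : Fin (s n) => t < |r n i j|).card) (Finset.mem_univ i)
  obtain ⟨j, hjA, hj⟩ := Finset.exists_mem_notMem_of_card_lt_card (hrow.trans_lt (hA ▸ h))
  exact (sInf_abs_image_le (r n i) A hjA).trans (by simpa using hj)

theorem le_gammafun_of_le_Gfun (s : ℕ → ℕ) (r : ∀ n, Fin (s n) → Fin (s n) → ℝ)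
    (hbdd : ∀ n i j, |r n i j| ≤ 1) {n b : ℕ} {t : ℝ} (hb : 0 < b)
    (h : b ≤ Gfun s r n t) : t ≤ gammafun s r n b := by
  obtain ⟨i, -, hi⟩ := (Finset.le_sup_iff hb).1 h
  obtain ⟨A, hAsub, hA⟩ := Finset.exists_subset_card_eq hi
  have hne : A.Nonempty := Finset.card_pos.1 (hA ▸ hb)
  have hle : t ≤ sInf ((fun j => |r n i j|) '' (A : Set (Fin (s n)))) := by
    refine le_csInf (Set.Nonempty.image _ hne) ?_
    rintro _ ⟨j, hj, rfl⟩
    exact (Finset.mem_filter.1 (hAsub hj)).2.le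
  refine hle.trans (le_csSup ⟨1, ?_⟩ ⟨i, A, hA, rfl⟩)
  rintro _ ⟨k, C, hC, rfl⟩
  obtain ⟨j, hj⟩ := Finset.card_pos.1 (hC ▸ hb)
  exact (sInf_abs_image_le (r n k) C hj).trans (hbdd n k j)

/-- An unbounded sequence of naturals takes arbitrarily large values arbitrarily late. -/
theorem frequently_le_of_unbounded {u : ℕ → ℕ} (hu : ∀ B, ∃ n, B < u n) (K : ℕ) :
    ∃ᶠ n in atTop, K ≤ u n := by
  rw [frequently_atTop]
  intro N
  obtain ⟨n, hn⟩ := hu (max K ((Finset.range N).sup u))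
  rw [max_lt_iff] at hn
  refine ⟨n, ?_, hn.1.le⟩
  by_contra! hlt
  exact (Finset.le_sup (f := u) (Finset.mem_range.2 hlt)).not_gt hn.2

/-- Every strictly increasing sequence of naturals has a left inverse tending to infinity. -/
theorem exists_leftInverse_tendsto_atTop {φ : ℕ → ℕ} (hφ : StrictMono φ) :
    ∃ b : ℕ → ℕ, Tendsto b atTop atTop ∧ ∀ k, b (φ k) = k := by
  refine ⟨fun n => Nat.findGreatest (fun k => φ k ≤ n) n, ?_, fun k => ?_⟩
  · refine tendsto_atTop.2 fun K => ?_
    filter_upwards [eventually_ge_atTop (φ K)] with n hn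
    exact Nat.le_findGreatest (P := fun k => φ k ≤ n) ((hφ.le_apply).trans hn) hn
  · refine le_antisymm ?_
      (Nat.le_findGreatest (P := fun j => φ j ≤ φ k) hφ.le_apply le_rfl)
    exact hφ.le_iff_le.1 (Nat.findGreatest_spec (P := fun j => φ j ≤ φ k)
      (m := k) hφ.le_apply le_rfl)

/-- For each `n`, let `Σ_n = (r_{n,i,j})` be a symmetric matrix with `|r_{n,i,j}| ≤ 1`, indexed
by a finite set `𝓘ₙ` with `|𝓘ₙ| = s_n → ∞`.  Then `γ(n, b_n) = o(1)` for every sequence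
`b_n → ∞` if and only if the sequence `(G_n(t))_{n ≥ 1}` is bounded for every `t > 0`. -/
theorem gamma_littleO_iff_G_bounded
    (s : ℕ → ℕ) (hs : Tendsto s atTop atTop)
    (r : ∀ n, Fin (s n) → Fin (s n) → ℝ)
    (hsymm : ∀ n i j, r n i j = r n j i)
    (hbdd : ∀ n i j, |r n i j| ≤ 1) :
    (∀ b : ℕ → ℕ, Tendsto b atTop atTop →
        Tendsto (fun n => gammafun s r n (b n)) atTop (nhds 0))
      ↔ (∀ t : ℝ, 0 < t → ∃ B : ℕ, ∀ n, Gfun s r n t ≤ B) := by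
  constructor
  · intro hγ t ht
    by_contra! hunb
    obtain ⟨φ, hφ, hG⟩ := extraction_forall_of_frequently (frequently_le_of_unbounded hunb)
    obtain ⟨b, hb, hbφ⟩ := exists_leftInverse_tendsto_atTop hφ
    have hlim := (hγ b hb).comp hφ.tendsto_atTop
    obtain ⟨k, hk, hk0⟩ := ((hlim.eventually_lt_const ht).and (eventually_gt_atTop 0)).exists
    simp only [Function.comp_apply, hbφ] at hk
    exact hk.not_ge (le_gammafun_of_le_Gfun s r hbdd hk0 (hG k))
  · intro hG b hb
    rw [Metric.tendsto_nhds]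
    intro ε hε
    obtain ⟨B, hB⟩ := hG (ε / 2) (half_pos hε)
    filter_upwards [hb.eventually_gt_atTop B] with n hn
    rw [Real.dist_eq, sub_zero, abs_of_nonneg (gammafun_nonneg s r n (b n))]
    exact (gammafun_le_of_Gfun_lt s r (half_pos hε).le ((hB n).trans_lt hn)).trans_lt
      (half_lt_self hε)
end

section
/- Suppose for each n ≥ 1, (A_{n,i})_{i∈𝓘_n} is a finite collection of events on some probability space. Let W_n = Σ_{i∈𝓘_n} 1_{A_{n,i}}, and for each d ≥ 1 define Q_{n,d} = Σ_{𝓐⊂𝓘_n, |𝓐|=d} P( ⋂_{i∈𝓐} A_{n,i} ). Suppose there exists λ > 0 such that lim_{n→∞} Q_{n,d} = λ^d/d! for every d ≥ 1. Then lim_{n→∞} P(W_n = k) = λ^k e^{−λ}/k! for every integer k ≥ 0. -/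
open MeasureTheory Finset Filter

open scoped Nat

theorem abs_ite_sub_alternating_sum_choose_le (N r : ℕ) :
    |(if N = 0 then (1 : ℝ) else 0) - ∑ j ∈ range r, (-1 : ℝ) ^ j * (N.choose j : ℝ)|
      ≤ (N.choose r : ℝ) := by
  obtain _ | M := N
  · obtain _ | r := r
    · simp
    · simp [Finset.sum_range_succ', Nat.choose_zero_succ]
  · obtain _ | r := r
    · simp
    · have h : ∑ j ∈ range (r + 1), (-1 : ℝ) ^ j * ((M + 1).choose j : ℝ)
          = (-1) ^ r * (M.choose r : ℝ) := by
        exact_mod_cast Int.alternating_sum_range_choose_eq_choose (n := M) (m := r)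
      rw [h, if_neg (Nat.succ_ne_zero M), zero_sub, abs_neg, abs_mul, abs_pow, abs_neg, abs_one,
        one_pow, one_mul, Nat.abs_cast]
      exact_mod_cast (Nat.choose_succ_succ M r ▸ Nat.le_add_right _ _)

/-- Truncated inclusion-exclusion (Bonferroni) for the indicator of `{k}`, with the first omitted
term as error bound. -/
theorem abs_ite_eq_sub_alternating_sum_choose_le (N k r : ℕ) :
    |(if N = k then (1 : ℝ) else 0)
        - ∑ j ∈ range r, (-1 : ℝ) ^ j * ((k + j).choose k : ℝ) * (N.choose (k + j) : ℝ)|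
      ≤ ((k + r).choose k : ℝ) * (N.choose (k + r) : ℝ) := by
  obtain hNk | hkN := lt_or_ge N k
  · have h (j : ℕ) : N.choose (k + j) = 0 := Nat.choose_eq_zero_of_lt (by omega)
    simp [h, hNk.ne]
  · obtain ⟨M, rfl⟩ := Nat.exists_eq_add_of_le hkN
    have h (j : ℕ) : ((k + j).choose k : ℝ) * ((k + M).choose (k + j) : ℝ)
        = ((k + M).choose k : ℝ) * (M.choose j : ℝ) := by
      have := Nat.choose_mul (n := k + M) (k := k + j) (s := k) (Nat.le_add_right k j)
      simp only [Nat.add_sub_cancel_left] at this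
      rw [mul_comm]
      exact_mod_cast this
    have hite : (if k + M = k then (1 : ℝ) else 0)
        = ((k + M).choose k : ℝ) * (if M = 0 then (1 : ℝ) else 0) := by
      by_cases hM : M = 0 <;> simp [hM]
    simp_rw [mul_assoc, h, mul_left_comm _ ((k + M).choose k : ℝ)]
    rw [hite, ← mul_sum, ← mul_sub, abs_mul, Nat.abs_cast]
    exact mul_le_mul_of_nonneg_left (abs_ite_sub_alternating_sum_choose_le M r) (Nat.cast_nonneg _)

theorem choose_sum_indicator_eq_sum_powersetCard {Ω ι : Type*} [Fintype ι] (A : ι → Set Ω)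
    (d : ℕ) (ω : Ω) :
    (((∑ i, (A i).indicator (fun _ => (1 : ℕ)) ω).choose d : ℕ) : ℝ)
      = ∑ s ∈ powersetCard d (univ : Finset ι),
          (⋂ i ∈ s, A i).indicator (fun _ => (1 : ℝ)) ω := by
  classical
  have h : ∑ i, (A i).indicator (fun _ => (1 : ℕ)) ω = #{i | ω ∈ A i} := by
    simp [Set.indicator_apply]
  rw [h, ← card_powersetCard]
  simp only [Set.indicator_apply, Finset.sum_boole]
  congr 2
  ext s
  simp only [mem_powersetCard, mem_filter, subset_iff, mem_univ, true_and, Set.mem_iInter,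
    implies_true]
  exact and_comm

theorem integrable_choose_sum_indicator {Ω ι : Type*} [Fintype ι] [MeasurableSpace Ω]
    (P : Measure Ω) [IsFiniteMeasure P] {A : ι → Set Ω} (hA : ∀ i, MeasurableSet (A i)) (d : ℕ) :
    Integrable
      (fun ω => (((∑ i, (A i).indicator (fun _ => (1 : ℕ)) ω).choose d : ℕ) : ℝ)) P := by
  simp_rw [choose_sum_indicator_eq_sum_powersetCard]
  exact integrable_finsetSum _ fun s _ =>
    (integrable_const 1).indicator (s.measurableSet_biInter fun i _ => hA i)

/-- The `d`-th binomial moment of a sum of indicators is the sum of the probabilities of the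
`d`-fold intersections. -/
theorem integral_choose_sum_indicator {Ω ι : Type*} [Fintype ι] [MeasurableSpace Ω]
    (P : Measure Ω) [IsFiniteMeasure P] {A : ι → Set Ω} (hA : ∀ i, MeasurableSet (A i)) (d : ℕ) :
    ∫ ω, (((∑ i, (A i).indicator (fun _ => (1 : ℕ)) ω).choose d : ℕ) : ℝ) ∂P
      = ∑ s ∈ powersetCard d (univ : Finset ι), (P (⋂ i ∈ s, A i)).toReal := by
  have hm (s : Finset ι) : MeasurableSet (⋂ i ∈ s, A i) :=
    s.measurableSet_biInter fun i _ => hA i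
  simp_rw [choose_sum_indicator_eq_sum_powersetCard]
  rw [integral_finsetSum _ fun s _ => (integrable_const 1).indicator (hm s)]
  refine sum_congr rfl fun s _ => ?_
  rw [integral_indicator_const _ (hm s), smul_eq_mul, mul_one, Measure.real]

/-- Bonferroni-type bound for the law of an integer variable through its binomial moments. -/
theorem abs_measure_eq_sub_alternating_sum_integral_choose_le {Ω : Type*} [MeasurableSpace Ω]
    (P : Measure Ω) [IsFiniteMeasure P] {W : Ω → ℕ} (hW : Measurable W)
    (hint : ∀ d, Integrable (fun ω => ((W ω).choose d : ℝ)) P) (k r : ℕ) :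
    |(P {ω | W ω = k}).toReal - ∑ j ∈ range r,
        (-1 : ℝ) ^ j * ((k + j).choose k : ℝ) * ∫ ω, ((W ω).choose (k + j) : ℝ) ∂P|
      ≤ ((k + r).choose k : ℝ) * ∫ ω, ((W ω).choose (k + r) : ℝ) ∂P := by
  have hm : MeasurableSet {ω | W ω = k} := hW (measurableSet_singleton k)
  have hind : (fun ω => if W ω = k then (1 : ℝ) else 0) = {ω | W ω = k}.indicator fun _ => 1 := by
    ext ω
    simp [Set.indicator_apply]
  have hP : (P {ω | W ω = k}).toReal = ∫ ω, (if W ω = k then (1 : ℝ) else 0) ∂P := by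
    rw [hind, integral_indicator_const _ hm, smul_eq_mul, mul_one, Measure.real]
  have hi : Integrable (fun ω => if W ω = k then (1 : ℝ) else 0) P := by
    rw [hind]
    exact (integrable_const 1).indicator hm
  have hj (j : ℕ) : Integrable
      (fun ω => (-1 : ℝ) ^ j * ((k + j).choose k : ℝ) * ((W ω).choose (k + j) : ℝ)) P :=
    (hint _).const_mul _
  simp_rw [hP, ← integral_const_mul]
  rw [← integral_finsetSum _ fun j _ => hj j,
    ← integral_sub hi (integrable_finsetSum _ fun j _ => hj j)]
  refine abs_integral_le_integral_abs.trans (integral_mono ?_ ((hint _).const_mul _) fun ω =>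
    abs_ite_eq_sub_alternating_sum_choose_le (W ω) k r)
  exact (hi.sub (integrable_finsetSum _ fun j _ => hj j)).abs

theorem tendsto_of_abs_sub_le_of_tendsto {a : ℕ → ℝ} {b c : ℕ → ℕ → ℝ} {B C : ℕ → ℝ} {L : ℝ}
    (h : ∀ r n, |a n - b r n| ≤ c r n) (hb : ∀ r, Tendsto (b r) atTop (nhds (B r)))
    (hc : ∀ r, Tendsto (c r) atTop (nhds (C r))) (hB : Tendsto B atTop (nhds L))
    (hC : Tendsto C atTop (nhds 0)) : Tendsto a atTop (nhds L) := by
  rw [Metric.tendsto_nhds]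
  intro ε hε
  obtain ⟨r, hBr, hCr⟩ := ((Metric.tendsto_nhds.1 hB (ε / 4) (by positivity)).and
    (Metric.tendsto_nhds.1 hC (ε / 4) (by positivity))).exists
  filter_upwards [Metric.tendsto_nhds.1 (hb r) (ε / 4) (by positivity),
    Metric.tendsto_nhds.1 (hc r) (ε / 4) (by positivity)] with n hbn hcn
  have hn := h r n
  simp only [Real.dist_eq, abs_lt, abs_le] at *
  constructor <;> linarith

theorem choose_mul_pow_div_factorial (x : ℝ) (k j : ℕ) :
    ((k + j).choose k : ℝ) * (x ^ (k + j) / ((k + j)! : ℝ))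
      = x ^ k / (k ! : ℝ) * (x ^ j / (j ! : ℝ)) := by
  rw [Nat.cast_add_choose, pow_add]
  have := Nat.factorial_pos (k + j)
  field_simp

/-- **Poisson approximation via the moment method.**
For each `n`, let `(A n i)_{i ∈ Fin (s n)}` be a finite collection of events on a probability
space `(Ω n, P n)`.  Let `W n = ∑ i, 1_{A n i}` and, for `d ≥ 1`,
`Q n d = ∑_{𝓐 ⊆ 𝓘ₙ, |𝓐| = d} P(⋂_{i ∈ 𝓐} A n i)`.  If there is `λ > 0` such that
`Q n d → λ^d / d!` for every `d ≥ 1`, then `P(W n = k) → λ^k e^{-λ} / k!` for every `k ≥ 0`. -/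
theorem poisson_approximation_moment_method
    {Ω : ℕ → Type*} [∀ n, MeasurableSpace (Ω n)]
    (P : ∀ n, Measure (Ω n)) [∀ n, IsProbabilityMeasure (P n)]
    (s : ℕ → ℕ) (A : ∀ n, Fin (s n) → Set (Ω n))
    (hA : ∀ n i, MeasurableSet (A n i))
    (W : ∀ n, Ω n → ℕ)
    (hW : ∀ n ω, W n ω = ∑ i : Fin (s n), (A n i).indicator (fun _ => (1 : ℕ)) ω)
    (Q : ℕ → ℕ → ℝ)
    (hQ : ∀ n d, Q n d = ∑ 𝓐 ∈ Finset.powersetCard d (Finset.univ : Finset (Fin (s n))),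
        ((P n) (⋂ i ∈ 𝓐, A n i)).toReal)
    (lam : ℝ) (hlam : 0 < lam)
    (hconv : ∀ d : ℕ, 1 ≤ d →
      Tendsto (fun n => Q n d) atTop (nhds (lam ^ d / (d.factorial : ℝ)))) :
    ∀ k : ℕ,
      Tendsto (fun n => ((P n) {ω | W n ω = k}).toReal) atTop
        (nhds (lam ^ k * Real.exp (-lam) / (k.factorial : ℝ))) := by
  have hW' (n : ℕ) : W n = fun ω => ∑ i, (A n i).indicator (fun _ => (1 : ℕ)) ω :=
    funext (hW n)
  have hWm (n : ℕ) : Measurable (W n) := by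
    rw [hW']
    exact Finset.measurable_fun_sum _ fun i _ => measurable_const.indicator (hA n i)
  have hint (n d : ℕ) : Integrable (fun ω => ((W n ω).choose d : ℝ)) (P n) := by
    rw [hW']
    exact integrable_choose_sum_indicator (P n) (hA n) d
  have hQW (n d : ℕ) : Q n d = ∫ ω, ((W n ω).choose d : ℝ) ∂P n := by
    rw [hQ, hW', integral_choose_sum_indicator (P n) (hA n) d]
  have hQlim (d : ℕ) : Tendsto (fun n => Q n d) atTop (nhds (lam ^ d / (d ! : ℝ))) := by
    obtain rfl | hd := Nat.eq_zero_or_pos d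
    · simp [hQ]
    · exact hconv d hd
  intro k
  refine tendsto_of_abs_sub_le_of_tendsto
    (b := fun r n => ∑ j ∈ range r, (-1 : ℝ) ^ j * ((k + j).choose k : ℝ) * Q n (k + j))
    (c := fun r n => ((k + r).choose k : ℝ) * Q n (k + r))
    (fun r n => ?_) (fun r => tendsto_finsetSum _ fun j _ => (hQlim (k + j)).const_mul _)
    (fun r => (hQlim (k + r)).const_mul _) ?_ ?_
  · simp_rw [hQW]
    exact abs_measure_eq_sub_alternating_sum_integral_choose_le (P n) (hWm n) (hint n) k r
  · have hexp : Tendsto (fun r => ∑ j ∈ range r, (-lam) ^ j / (j ! : ℝ)) atTop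
        (nhds (Real.exp (-lam))) := by
      rw [Real.exp_eq_exp_ℝ]
      exact (NormedSpace.expSeries_div_hasSum_exp (-lam)).tendsto_sum_nat
    convert hexp.const_mul (lam ^ k / (k ! : ℝ)) using 2 with r
    · rw [mul_sum]
      refine sum_congr rfl fun j _ => ?_
      rw [mul_assoc, choose_mul_pow_div_factorial, neg_pow]
      ring
    · ring
  · simp_rw [choose_mul_pow_div_factorial]
    simpa using (FloorSemiring.tendsto_pow_div_factorial_atTop lam).const_mul
      (lam ^ k / (k ! : ℝ))
end
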